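/- Let (W,S) be the affine Coxeter system of type F̃_4: S = {0,1,2,3,4} with m(0,1) = 3, m(1,2) = 3, m(2,3) = 4, m(3,4) = 3 and all other pairs commuting (m = 2). Then the homology of the weighted complex C_*(W) is: H_0 ≅ R/(Φ_2); H_1 ≅ R/(Φ_2); H_2 ≅ R/(Φ_2) ⊕ R/(Φ_3); H_3 ≅ (R/(Φ_2))² ⊕ R/(Φ_3) ⊕ R/(Φ_4) ⊕ R/(Φ_8); H_4 ≅ R; and H_k = 0 for all k ≥ 5. -/

import Mathlib

open Polynomial CoxeterSystem

set_option synthInstance.maxHeartbeats 1000000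
set_option maxHeartbeats 1000000

noncomputable section

/-- The ring `R = ℚ[q,q⁻¹]` of Laurent polynomials over `ℚ`. -/
abbrev R : Type := LaurentPolynomial ℚ

/-- The image of the `d`-th cyclotomic polynomial `Φ_d` in `R`. -/
def cyc (d : ℕ) : R := Polynomial.toLaurent (Polynomial.cyclotomic d ℚ)

/-- The `R`-module `R/(Φ_d)`. -/
abbrev CycQuot (d : ℕ) := R ⧸ Ideal.span {cyc d}

variable {B : Type*} [Fintype B] [LinearOrder B] {W : Type*} [Group W]
  {M : CoxeterMatrix B} (cs : CoxeterSystem M W)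

/-- The standard parabolic subgroup `W_σ` generated by `σ ⊆ S`. -/
def parabolic (σ : Finset B) : Subgroup W := Subgroup.closure (cs.simple '' σ)

/-- The Poincaré polynomial `W_σ(q) = Σ_{w ∈ W_σ} q^{ℓ(w)}` of the standard parabolic
subgroup `W_σ` (defined to be `0` if `W_σ` is infinite). -/
def poin (σ : Finset B) : ℚ[X] :=
  letI := Classical.dec ((parabolic cs σ : Set W).Finite)
  if h : (parabolic cs σ : Set W).Finite then ∑ w ∈ h.toFinset, X ^ cs.length w else 0

/-- The set of simplices `σ ∈ K_W` with `|σ| = k`, i.e. the subsets of `S` of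
cardinality `k` generating a finite standard parabolic subgroup. -/
abbrev KW (k : ℕ) := {σ : Finset B // σ.card = k ∧ (parabolic cs σ : Set W).Finite}

noncomputable instance (k : ℕ) : Fintype (KW cs k) := Fintype.ofFinite _

/-- The coefficient of `e_τ` in `∂ e_σ`: it is
`(−1)^{#{t ∈ σ : t < s}} · W_σ(q)/W_{σ∖{s}}(q)` if `τ = σ ∖ {s}` for some `s ∈ σ`,
and `0` otherwise. -/
def bcoeff (σ τ : Finset B) : R :=
  ∑ s ∈ σ, if τ = σ.erase s then
      (-1 : R) ^ (σ.filter (fun t => t < s)).card *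
        Polynomial.toLaurent (poin cs σ / poin cs τ)
    else 0

/-- The boundary map `∂ : C_{k+1} → C_k` of the weighted complex `C_*(W)`, where
`C_k = ⊕_{σ ∈ K_W, |σ| = k} R·e_σ`. -/
def bdry (k : ℕ) : (KW cs (k + 1) → R) →ₗ[R] (KW cs k → R) :=
  Matrix.mulVecLin (Matrix.of fun (τ : KW cs k) (σ : KW cs (k + 1)) => bcoeff cs σ.1 τ.1)

/-- The submodule of cycles in degree `k` of the weighted complex. -/
def cycles : (k : ℕ) → Submodule R (KW cs k → R)
  | 0 => ⊤
  | (k + 1) => LinearMap.ker (bdry cs k)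

/-- The `k`-th homology `H_k(C_*(W))` of the weighted complex: cycles modulo boundaries. -/
abbrev Hgy (k : ℕ) :=
  cycles cs k ⧸ Submodule.comap (cycles cs k).subtype (LinearMap.range (bdry cs k))

end

/-! ### Integer polynomials as coefficient lists -/

/-- The polynomial with integer coefficient list `l` (lowest degree first). -/
noncomputable def listPoly : List ℤ → ℚ[X]
  | [] => 0
  | a :: l => C (a : ℚ) + X * listPoly l

/-- Addition of coefficient lists. -/
def listAdd : List ℤ → List ℤ → List ℤ
  | [], l => l
  | a :: k, [] => a :: k
  | a :: k, b :: l => (a + b) :: listAdd k l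

/-- Scaling of a coefficient list. -/
def listScale (c : ℤ) (l : List ℤ) : List ℤ := l.map (c * ·)

/-- Multiplication of coefficient lists. -/
def listMul : List ℤ → List ℤ → List ℤ
  | [], _ => []
  | a :: k, l => if a = 0 then 0 :: listMul k l else listAdd (listScale a l) (0 :: listMul k l)

/-- Equality of coefficient lists up to trailing zeros. -/
def listEq (k l : List ℤ) : Bool := (listAdd k (listScale (-1) l)).all (· == 0)

theorem listPoly_add (k l : List ℤ) : listPoly (listAdd k l) = listPoly k + listPoly l := by
  induction k generalizing l with
  | nil => simp [listAdd, listPoly]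
  | cons a k ih =>
    cases l with
    | nil => simp [listAdd, listPoly]
    | cons b l => simp only [listAdd, listPoly, ih, Int.cast_add, C_add]; ring

theorem listPoly_scale (c : ℤ) (l : List ℤ) :
    listPoly (listScale c l) = C (c : ℚ) * listPoly l := by
  induction l with
  | nil => simp [listScale, listPoly]
  | cons a l ih =>
    have : listScale c (a :: l) = (c * a) :: listScale c l := rfl
    rw [this, listPoly, listPoly, ih, Int.cast_mul, C_mul]; ring

theorem listPoly_mul (k l : List ℤ) : listPoly (listMul k l) = listPoly k * listPoly l := by
  induction k with
  | nil => simp [listMul, listPoly]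
  | cons a k ih =>
    by_cases h : a = 0
    · simp only [listMul, h, if_true, listPoly, ih, Int.cast_zero, C_0]; ring
    · simp only [listMul, h, if_false, listPoly, listPoly_add, listPoly_scale, ih, Int.cast_zero,
        C_0]; ring

theorem listPoly_eq_zero {l : List ℤ} (h : l.all (· == 0) = true) : listPoly l = 0 := by
  induction l with
  | nil => rfl
  | cons a l ih =>
    simp only [List.all_cons, Bool.and_eq_true, beq_iff_eq] at h
    simp [listPoly, ih h.2, h.1]

theorem listPoly_eq {k l : List ℤ} (h : listEq k l = true) : listPoly k = listPoly l := by
  have := listPoly_eq_zero h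
  rw [listPoly_add, listPoly_scale] at this
  simpa [← sub_eq_add_neg, sub_eq_zero] using this

/-! ### The action of the affine Weyl group on the affine real roots

The affine real roots are numbered by `ℤ`, with the positive roots numbered by the nonnegative
integers, the negative of root `x` being `-1 - x`, and adding the imaginary root to root `x`
giving root `x + 48`. -/

/-- The displacements of the roots `0, …, 47` under the simple reflections. -/
def shiftTable : List (List ℤ) :=
  [[0, 0, 0, 0, 21, 21, 21, 21, 21, 0, 0, 0, 0, 18, 18, 18, 18, 0, 21, 21, 21, 21, 21, 49, -49,
    -21, -21, -21, -21, -21, 0, -18, -18, -18, -18, 0, 0, 0, 0, -21, -21, -21, -21, -21, 0, 0, 0,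
    0], [0, 4, 4, 4, -9, -4, -4, -4, 0, 0, 0, 2, 2, -2, -2, 0, 0, 1, -1, 0, 0, 0, 1, -1, 1, -1, 0,
    0, 0, 1, -1, 0, 0, 2, 2, -2, -2, 0, 0, 0, 4, 4, 4, 9, -4, -4, -4, 0], [2, -3, -2, 0, 1, -1, 0,
    1, -1, 0, 1, -1, 0, 0, 1, -1, 0, 0, 1, -1, 0, 1, -1, 0, 0, 1, -1, 0, 1, -1, 0, 0, 1, -1, 0, 0,
    1, -1, 0, 1, -1, 0, 1, -1, 0, 2, 3, -2], [-1, 2, 0, -2, 0, 2, 0, -2, 0, 1, -1, 1, -1, 1, -1,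
    1, -1, 0, 0, 2, 0, -2, 0, 0, 0, 0, 2, 0, -2, 0, 0, 1, -1, 1, -1, 1, -1, 1, -1, 0, 2, 0, -2, 0,
    2, 0, -2, 1], [10, 0, 9, 14, 0, 0, 7, 11, 11, -19, -10, -9, 0, -7, 0, 0, 4, -14, -11, -11, -4,
    0, 0, 0, 0, 0, 0, 4, 11, 11, 14, -4, 0, 0, 7, 0, 9, 10, 19, -11, -11, -7, 0, 0, -14, -9, 0,
    -10]]

/-- The action of a simple reflection on the numbered roots. -/
def reflRoot (i : Fin 5) (x : ℤ) : ℤ :=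
  x + ((shiftTable.getD i []).getD (x % 48).toNat 0)

/-- The action of a simple reflection, as an element of the endomorphism monoid. -/
def reflEnd (i : Fin 5) : Function.End ℤ := reflRoot i

/-- The action of a word on the numbered roots. -/
def actWord (ω : List (Fin 5)) (x : ℤ) : ℤ := ω.foldr reflRoot x

/-- The Coxeter matrix of type `F̃₄`. -/
def coxF4 (i j : Fin 5) : ℕ :=
  if i = j then 1 else
    (([[1, 3, 2, 2, 2], [3, 1, 3, 2, 2], [2, 3, 1, 4, 2], [2, 2, 4, 1, 3], [2, 2, 2, 3, 1]] :
      List (List ℕ)).getD i []).getD j 2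

/-- The number of the simple root `α_i`. -/
def simpleRoot (i : Fin 5) : ℤ := [24, 4, 1, 0, 9].getD i 0

theorem reflRoot_add (i : Fin 5) (x n : ℤ) : reflRoot i (x + 48 * n) = reflRoot i x + 48 * n := by
  unfold reflRoot
  rw [Int.add_mul_emod_self_left]; ring

theorem actWord_add (ω : List (Fin 5)) (x n : ℤ) :
    actWord ω (x + 48 * n) = actWord ω x + 48 * n := by
  induction ω with
  | nil => rfl
  | cons i ω ih =>
    change reflRoot i (actWord ω _) = reflRoot i (actWord ω x) + _
    rw [ih, reflRoot_add]

theorem forall_of_residues {p : ℤ → Prop} (hp : ∀ x n, p x → p (x + 48 * n))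
    (h : ∀ k ∈ List.range 48, p (k : ℤ)) (x : ℤ) : p x := by
  have h0 : 0 ≤ x % 48 := Int.emod_nonneg _ (by norm_num)
  have h1 : x % 48 < 48 := Int.emod_lt_of_pos _ (by norm_num)
  have := hp ((x % 48).toNat : ℤ) (x / 48) (h _ (by rw [List.mem_range]; omega))
  rwa [Int.toNat_of_nonneg h0, Int.emod_add_mul_ediv] at this

theorem reflRoot_neg (i : Fin 5) (x : ℤ) : reflRoot i (-1 - x) = -1 - reflRoot i x := by
  revert x
  refine forall_of_residues (fun x n h => ?_) ?_
  · have e : -1 - (x + 48 * n) = (-1 - x) + 48 * (-n) := by ring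
    rw [e, reflRoot_add, reflRoot_add, h]; ring
  · revert i; decide +kernel

theorem reflRoot_braid (i j : Fin 5) (x : ℤ) :
    ((fun y => reflRoot i (reflRoot j y))^[coxF4 i j]) x = x := by
  have h : ∀ m, ∀ x n : ℤ, ((fun y => reflRoot i (reflRoot j y))^[m]) (x + 48 * n) =
      ((fun y => reflRoot i (reflRoot j y))^[m]) x + 48 * n := by
    intro m
    induction m with
    | zero => intro x n; rfl
    | succ m ih =>
      intro x n
      rw [Function.iterate_succ_apply, Function.iterate_succ_apply, reflRoot_add, reflRoot_add, ih]
  revert x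
  refine forall_of_residues (fun x n hx => ?_) ?_
  · rw [h, hx]
  · clear h; revert i j; decide +kernel

theorem reflRoot_neg_iff (i : Fin 5) {x : ℤ} (hx : 0 ≤ x) (h : reflRoot i x < 0) :
    x = simpleRoot i := by
  have key : ∀ i : Fin 5, ∀ k ∈ List.range 48, -48 ≤ reflRoot i (k : ℤ) ∧
      (reflRoot i (k : ℤ) < 0 → (k : ℤ) = simpleRoot i) := by decide +kernel
  have h0 : 0 ≤ x % 48 := Int.emod_nonneg _ (by norm_num)
  have h1 : x % 48 < 48 := Int.emod_lt_of_pos _ (by norm_num)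
  have h2 := Int.emod_add_mul_ediv x 48
  have h3 := key i (x % 48).toNat (by rw [List.mem_range]; omega)
  rw [Int.toNat_of_nonneg h0] at h3
  rw [← h2, reflRoot_add] at h
  have h4 : x / 48 = 0 := by
    have : 0 ≤ x / 48 := Int.ediv_nonneg hx (by norm_num)
    omega
  rw [h4] at h h2
  have := h3.2 (by simpa using h)
  omega

/-! ### Words and braid moves -/

/-- The word `i, j, i, …` of length `m`. -/
def altWord (i j : Fin 5) : ℕ → List (Fin 5)
  | 0 => []
  | m + 1 => i :: altWord j i m

/-- Delete a square, or apply a braid move, at the front of the word. -/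
def headMove : List (Fin 5) → List (Fin 5)
  | i :: j :: l =>
    if i = j then l
    else if (i :: j :: l).take (coxF4 i j) = altWord i j (coxF4 i j) then
      altWord j i (coxF4 i j) ++ (i :: j :: l).drop (coxF4 i j)
    else i :: j :: l
  | l => l

/-- Apply a move at the given position of the word. -/
def moveAt : ℕ → List (Fin 5) → List (Fin 5)
  | 0, l => headMove l
  | _ + 1, [] => []
  | p + 1, i :: l => i :: moveAt p l

section Coxeter

variable {W : Type*} [Group W] {Mat : CoxeterMatrix (Fin 5)} (cs : CoxeterSystem Mat W)

theorem wordProd_altWord (hM : ∀ i j, Mat.M i j = coxF4 i j) {i j : Fin 5} (hij : i ≠ j) :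
    cs.wordProd (altWord i j (coxF4 i j)) = cs.wordProd (altWord j i (coxF4 i j)) := by
  have key : (cs.simple i * cs.simple j) ^ coxF4 i j = 1 := by
    rw [← hM]; exact cs.simple_mul_simple_pow i j
  have hm : coxF4 i j = 2 ∨ coxF4 i j = 3 ∨ coxF4 i j = 4 := by
    clear key; revert i j; decide +kernel
  have inv : ∀ a b : W, a * b = 1 → a = b⁻¹ := fun a b h => eq_inv_of_mul_eq_one_left h
  rcases hm with h | h | h <;> rw [h] at key ⊢ <;>
    simp only [altWord, cs.wordProd_cons, cs.wordProd_nil, mul_one]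
  · have := inv (cs.simple i * cs.simple j) (cs.simple i * cs.simple j)
      (by rw [← key]; simp only [pow_succ, pow_zero, one_mul, mul_assoc])
    simpa [mul_assoc] using this
  · have := inv (cs.simple i * (cs.simple j * cs.simple i))
      (cs.simple j * (cs.simple i * cs.simple j))
      (by rw [← key]; simp only [pow_succ, pow_zero, one_mul, mul_assoc])
    simpa [mul_assoc] using this
  · have := inv (cs.simple i * (cs.simple j * (cs.simple i * cs.simple j)))
      (cs.simple i * (cs.simple j * (cs.simple i * cs.simple j)))
      (by rw [← key]; simp only [pow_succ, pow_zero, one_mul, mul_assoc])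
    simpa [mul_assoc] using this

theorem wordProd_headMove (hM : ∀ i j, Mat.M i j = coxF4 i j) (l : List (Fin 5)) :
    cs.wordProd (headMove l) = cs.wordProd l := by
  unfold headMove
  split
  · rename_i i j l
    split_ifs with h1 h2
    · subst h1; simp [cs.wordProd_cons]
    · rw [cs.wordProd_append, ← wordProd_altWord cs hM h1, ← h2, ← cs.wordProd_append,
        List.take_append_drop]
    · rfl
  · rfl

theorem wordProd_moveAt (hM : ∀ i j, Mat.M i j = coxF4 i j) (p : ℕ) (l : List (Fin 5)) :
    cs.wordProd (moveAt p l) = cs.wordProd l := by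
  induction p generalizing l with
  | zero => exact wordProd_headMove cs hM l
  | succ p ih =>
    cases l with
    | nil => rfl
    | cons i l => simp only [moveAt, cs.wordProd_cons, ih]

theorem wordProd_moves (hM : ∀ i j, Mat.M i j = coxF4 i j) (ps : List ℕ) (l : List (Fin 5)) :
    cs.wordProd (ps.foldl (fun l p => moveAt p l) l) = cs.wordProd l := by
  induction ps generalizing l with
  | nil => rfl
  | cons p ps ih => simp only [List.foldl_cons, ih, wordProd_moveAt cs hM]

/-- The representation of `W` on the numbered roots. -/
theorem exists_action (hM : ∀ i j, Mat.M i j = coxF4 i j) :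
    ∃ ρ : W →* Function.End ℤ, ∀ i, ρ (cs.simple i) = reflEnd i := by
  have hl : Mat.IsLiftable reflEnd := by
    intro i j
    have h : ∀ m : ℕ, (reflEnd i * reflEnd j) ^ m =
        ((fun y => reflRoot i (reflRoot j y))^[m] : ℤ → ℤ) := by
      intro m
      induction m with
      | zero => rfl
      | succ m ih => rw [pow_succ, ih, Function.iterate_succ]; rfl
    have e : Mat i j = coxF4 i j := hM i j
    rw [e, h]
    funext x
    exact reflRoot_braid i j x
  exact ⟨cs.lift ⟨_, hl⟩, fun i => cs.lift_apply_simple hl i⟩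

end Coxeter

/-! ### Parabolic subgroups and their Poincaré polynomials -/

/-- Data attached to a parabolic subgroup: the node to remove, the positive roots,
the Poincaré polynomial, and the minimal coset representatives modulo the smaller parabolic
subgroup, each with the positions of the moves describing left multiplication by generators. -/
structure ParabolicData where
  /-- the node that is removed -/
  node : Fin 5
  /-- the positive roots of the parabolic subgroup -/
  roots : List ℤ
  /-- the Poincaré polynomial -/
  poly : List ℤ
  /-- the minimal coset representatives, with derivations -/
  reps : List (List (Fin 5) × List (List ℕ))

/-- Data for the proper parabolic subgroups, indexed by bit masks. -/
def parabolicTable : List ParabolicData :=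
  [
    ⟨0, [], [1], []⟩,
    ⟨0, [24], [1, 1],
      [([], [[]]), ([0], [[0]])]⟩,
    ⟨1, [4], [1, 1],
      [([], [[]]), ([1], [[0]])]⟩,
    ⟨0, [4, 24, 25], [1, 2, 2, 1],
      [([], [[]]), ([0], [[0], []]), ([1, 0], [[0]])]⟩,
    ⟨2, [1], [1, 1],
      [([], [[]]), ([2], [[0]])]⟩,
    ⟨0, [1, 24], [1, 2, 1],
      [([], [[]]), ([0], [[0]])]⟩,
    ⟨1, [1, 4, 5], [1, 2, 2, 1],
      [([], [[]]), ([1], [[0], []]), ([2, 1], [[0]])]⟩,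
    ⟨0, [1, 4, 5, 24, 25, 26], [1, 3, 5, 6, 5, 3, 1],
      [([], [[]]), ([0], [[0], []]), ([1, 0], [[0], []]), ([2, 1, 0], [[0, 1], [0, 2], [0]])]⟩,
    ⟨3, [0], [1, 1],
      [([], [[]]), ([3], [[0]])]⟩,
    ⟨0, [0, 24], [1, 2, 1],
      [([], [[]]), ([0], [[0]])]⟩,
    ⟨1, [0, 4], [1, 2, 1],
      [([], [[]]), ([1], [[0]])]⟩,
    ⟨3, [0, 4, 24, 25], [1, 3, 4, 3, 1],
      [([], [[]]), ([3], [[0]])]⟩,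
    ⟨2, [0, 1, 2, 3], [1, 2, 2, 2, 1],
      [([], [[]]), ([2], [[0], []]), ([3, 2], [[], [0]]), ([2, 3, 2], [[0]])]⟩,
    ⟨0, [0, 1, 2, 3, 24], [1, 3, 4, 4, 3, 1],
      [([], [[]]), ([0], [[0]])]⟩,
    ⟨1, [0, 1, 2, 3, 4, 5, 6, 7, 8], [1, 3, 5, 7, 8, 8, 7, 5, 3, 1],
      [([], [[]]), ([1], [[0], []]), ([2, 1], [[0], []]), ([3, 2, 1], [[0, 1], [], [0]]), ([2, 3,
      2, 1], [[], [0], [0, 3]]), ([1, 2, 3, 2, 1], [[0], [0, 2, 3], [0, 1, 4]])]⟩,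
    ⟨0, [0, 1, 2, 3, 4, 5, 6, 7, 8, 24, 25, 26, 27, 28, 29, 30], [1, 4, 9, 16, 24, 32, 39, 44, 46,
    44, 39, 32, 24, 16, 9, 4, 1],
      [([], [[]]), ([0], [[0], []]), ([1, 0], [[0], [], [0, 1]]), ([2, 1, 0], [[0, 1], [0, 2],
      [0], []]), ([3, 2, 1, 0], [[0, 1, 2], [0, 1, 3], [], [0]]), ([2, 3, 2, 1, 0], [[0, 1, 2, 3],
      [], [0], [0, 3, 4]]), ([1, 2, 3, 2, 1, 0], [[], [0], [0, 2, 3, 5], [0, 1, 4, 5]]), ([0, 1,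
      2, 3, 2, 1, 0], [[0], [0, 2, 3, 4, 5], [0, 1, 3, 4, 6], [0, 1, 2, 5, 6]])]⟩,
    ⟨4, [9], [1, 1],
      [([], [[]]), ([4], [[0]])]⟩,
    ⟨0, [9, 24], [1, 2, 1],
      [([], [[]]), ([0], [[0]])]⟩,
    ⟨1, [4, 9], [1, 2, 1],
      [([], [[]]), ([1], [[0]])]⟩,
    ⟨4, [4, 9, 24, 25], [1, 3, 4, 3, 1],
      [([], [[]]), ([4], [[0]])]⟩,
    ⟨2, [1, 9], [1, 2, 1],
      [([], [[]]), ([2], [[0]])]⟩,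
    ⟨0, [1, 9, 24], [1, 3, 3, 1],
      [([], [[]]), ([0], [[0]])]⟩,
    ⟨4, [1, 4, 5, 9], [1, 3, 4, 3, 1],
      [([], [[]]), ([4], [[0]])]⟩,
    ⟨4, [1, 4, 5, 9, 24, 25, 26], [1, 4, 8, 11, 11, 8, 4, 1],
      [([], [[]]), ([4], [[0]])]⟩,
    ⟨3, [0, 9, 10], [1, 2, 2, 1],
      [([], [[]]), ([3], [[0], []]), ([4, 3], [[0]])]⟩,
    ⟨0, [0, 9, 10, 24], [1, 3, 4, 3, 1],
      [([], [[]]), ([0], [[0]])]⟩,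
    ⟨1, [0, 4, 9, 10], [1, 3, 4, 3, 1],
      [([], [[]]), ([1], [[0]])]⟩,
    ⟨0, [0, 4, 9, 10, 24, 25], [1, 4, 8, 10, 8, 4, 1],
      [([], [[]]), ([0], [[0], []]), ([1, 0], [[0], [0, 1]])]⟩,
    ⟨4, [0, 1, 2, 3, 9, 10, 11, 12, 17], [1, 3, 5, 7, 8, 8, 7, 5, 3, 1],
      [([], [[]]), ([4], [[0], []]), ([3, 4], [[], [0]]), ([2, 3, 4], [[0], [], [0, 1]]), ([3, 2,
      3, 4], [[0, 3], [0], []]), ([4, 3, 2, 3, 4], [[0, 1, 4], [0, 2, 3], [0]])]⟩,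
    ⟨0, [0, 1, 2, 3, 9, 10, 11, 12, 17, 24], [1, 4, 8, 12, 15, 16, 15, 12, 8, 4, 1],
      [([], [[]]), ([0], [[0]])]⟩,
    ⟨1, [0, 1, 2, 3, 4, 5, 6, 7, 8, 9, 10, 11, 12, 13, 14, 15, 16, 17, 18, 19, 20, 21, 22, 23],
    [1, 4, 9, 16, 25, 36, 48, 60, 71, 80, 87, 92, 94, 92, 87, 80, 71, 60, 48, 36, 25, 16, 9, 4,
    1],
      [([], [[]]), ([1], [[0], []]), ([2, 1], [[0], [], [0, 1]]), ([3, 2, 1], [[0, 1], [], [0]]),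
      ([2, 3, 2, 1], [[], [0], [0, 3]]), ([4, 3, 2, 1], [[0, 1, 2], [0], [0, 2, 3]]), ([1, 2, 3,
      2, 1], [[0], [0, 2, 3], [0, 1, 4], []]), ([4, 2, 3, 2, 1], [[0], [0, 1], []]), ([4, 1, 2, 3,
      2, 1], [[0, 1], [0, 1, 3, 4], [], [0]]), ([3, 4, 2, 3, 2, 1], [[0, 1], [], [0], [0, 2, 5]]),
      ([3, 4, 1, 2, 3, 2, 1], [[0, 1, 2], [], [0], [0, 2, 3, 6]]), ([2, 3, 4, 2, 3, 2, 1], [[],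
      [0], [3, 0, 3, 2, 5, 6], [0, 1, 3, 6]]), ([2, 3, 4, 1, 2, 3, 2, 1], [[], [0], [0, 1, 3, 4,
      7]]), ([1, 2, 3, 4, 2, 3, 2, 1], [[0], [0, 2, 3], [0, 4, 1, 4, 3, 6, 7], [0, 1, 2, 4, 7]]),
      ([1, 2, 3, 4, 1, 2, 3, 2, 1], [[0], [0, 2, 3, 4], [], [0, 1, 2, 4, 5, 8]]), ([3, 2, 3, 4, 1,
      2, 3, 2, 1], [[0], [0, 3, 4, 6, 7], []]), ([3, 1, 2, 3, 4, 1, 2, 3, 2, 1], [[0, 1], [],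
      [0]]), ([4, 3, 2, 3, 4, 1, 2, 3, 2, 1], [[0, 1], [0, 1, 4, 5, 7, 8], [0, 2, 3, 5, 6, 9],
      [0]]), ([2, 3, 1, 2, 3, 4, 1, 2, 3, 2, 1], [[2, 0, 2, 1, 5, 6, 8, 9], [0], [6, 5, 3, 0, 3,
      7, 4, 2, 4, 7, 6, 5, 9, 10], []]), ([4, 3, 1, 2, 3, 4, 1, 2, 3, 2, 1], [[0, 1, 2], [0], [0,
      2, 3, 4, 6, 7, 10]]), ([4, 2, 3, 1, 2, 3, 4, 1, 2, 3, 2, 1], [[0, 3, 1, 3, 2, 6, 7, 9, 10],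
      [0, 1], [], [0]]), ([3, 4, 2, 3, 1, 2, 3, 4, 1, 2, 3, 2, 1], [[0, 1, 4, 2, 4, 3, 7, 8, 10,
      11], [], [0], [0, 8, 7, 5, 2, 5, 9, 6, 4, 6, 9, 8, 7, 11, 12]]), ([2, 3, 4, 2, 3, 1, 2, 3,
      4, 1, 2, 3, 2, 1], [[], [0], [3, 0, 3, 2, 5, 6, 7, 9, 10, 13], [0, 1, 9, 8, 6, 3, 6, 10, 7,
      5, 7, 10, 9, 8, 12, 13]]), ([1, 2, 3, 4, 2, 3, 1, 2, 3, 4, 1, 2, 3, 2, 1], [[0], [0, 2, 3,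
      6, 4, 6, 5, 9, 10, 12, 13], [0, 4, 1, 4, 3, 6, 7, 8, 10, 11, 14], [0, 1, 2, 10, 9, 7, 4, 7,
      11, 8, 6, 8, 11, 10, 9, 13, 14]])]⟩]

/-- The bit mask of a set of nodes. -/
def bitMask (σ : Finset (Fin 5)) : ℕ :=
  (if 0 ∈ σ then 1 else 0) + (if 1 ∈ σ then 2 else 0) + (if 2 ∈ σ then 4 else 0) +
    (if 3 ∈ σ then 8 else 0) + (if 4 ∈ σ then 16 else 0)

/-- The data of the parabolic subgroup generated by `σ`. -/
def parabolicData (σ : Finset (Fin 5)) : ParabolicData :=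
  parabolicTable.getD (bitMask σ) ⟨0, [], [1], []⟩

/-- The roots `Q` are positive, contain the simple roots of `σ`, and are stable under `W_σ`
up to sign. -/
def rootsStable (σ : Finset (Fin 5)) (Q : List ℤ) : Prop :=
  (∀ x ∈ Q, 0 ≤ x) ∧
    ∀ t ∈ σ, simpleRoot t ∈ Q ∧ ∀ x ∈ Q, reflRoot t x ∈ Q ∨ -1 - reflRoot t x ∈ Q

instance (σ : Finset (Fin 5)) (Q : List ℤ) : Decidable (rootsStable σ Q) := by
  unfold rootsStable; infer_instance

/-- The coset representatives `X` form a transversal of `W_τ` in `W_σ` consisting of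
elements of minimal length. -/
def repsValid (σ τ : Finset (Fin 5)) (Q Q' : List ℤ) (X : List (List (Fin 5) × List (List ℕ))) :
    Prop :=
  Q.Nodup ∧ (∀ x ∈ Q, 0 ≤ x) ∧ ([] ∈ X.map Prod.fst) ∧
  (X.map fun ω => (List.range 25).map fun k => actWord ω.1 (k : ℤ)).Nodup ∧
  ∀ ω ∈ X, (∀ i ∈ ω.1, i ∈ σ) ∧ (∀ x ∈ Q', 0 ≤ actWord ω.1 x) ∧
    ω.1.length ≤ (Q.filter fun x => x ∉ Q' ∧ actWord ω.1 x < 0).length ∧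
    ∀ s ∈ σ, ∃ ps ∈ ω.2,
      ps.foldl (fun l p => moveAt p l) (s :: ω.1) ∈ X.map Prod.fst ∨
        ∃ t ∈ τ, ps.foldl (fun l p => moveAt p l) (s :: ω.1) = ω.1 ++ [t]

instance (σ τ : Finset (Fin 5)) (Q Q' : List ℤ) (X : List (List (Fin 5) × List (List ℕ))) :
    Decidable (repsValid σ τ Q Q' X) := by
  unfold repsValid; infer_instance

theorem rootsStable_parabolicData :
    ∀ σ : Finset (Fin 5), σ ≠ Finset.univ → rootsStable σ (parabolicData σ).roots := by
  decide +kernel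

theorem repsValid_parabolicData :
    ∀ σ : Finset (Fin 5), σ ≠ Finset.univ → σ ≠ ∅ →
      (parabolicData σ).node ∈ σ ∧
      repsValid σ (σ.erase (parabolicData σ).node) (parabolicData σ).roots
        (parabolicData (σ.erase (parabolicData σ).node)).roots (parabolicData σ).reps ∧
      listEq (parabolicData σ).poly
        (listMul ((parabolicData σ).reps.foldr
          (fun ω l => listAdd (List.replicate ω.1.length 0 ++ [1]) l) [])
          (parabolicData (σ.erase (parabolicData σ).node)).poly) = true := by
  decide +kernel

section Parabolic

variable {W : Type*} [Group W] {Mat : CoxeterMatrix (Fin 5)} (cs : CoxeterSystem Mat W)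
  {ρ : W →* Function.End ℤ}

theorem action_wordProd (hρ : ∀ i, ρ (cs.simple i) = reflEnd i) (ω : List (Fin 5)) (x : ℤ) :
    ρ (cs.wordProd ω) x = actWord ω x := by
  induction ω generalizing x with
  | nil => rw [cs.wordProd_nil, map_one]; rfl
  | cons i ω ih =>
    rw [cs.wordProd_cons, map_mul, hρ]
    exact congrArg (reflRoot i) (ih x)

theorem action_simple_mul (hρ : ∀ i, ρ (cs.simple i) = reflEnd i) (i : Fin 5) (w : W) (x : ℤ) :
    ρ (cs.simple i * w) x = reflRoot i (ρ w x) := by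
  rw [map_mul, hρ]; rfl

theorem action_mul (w w' : W) (x : ℤ) : ρ (w * w') x = ρ w (ρ w' x) := by
  rw [map_mul]; rfl

theorem action_one (x : ℤ) : ρ 1 x = x := by
  rw [map_one]; rfl

theorem action_inv_self (w : W) (x : ℤ) : ρ w (ρ w⁻¹ x) = x := by
  rw [← action_mul, mul_inv_cancel, action_one]

theorem action_self_inv (w : W) (x : ℤ) : ρ w⁻¹ (ρ w x) = x := by
  rw [← action_mul, inv_mul_cancel, action_one]

theorem action_injective (w : W) : Function.Injective (ρ w : ℤ → ℤ) :=
  Function.LeftInverse.injective (action_self_inv w)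

theorem action_neg (hρ : ∀ i, ρ (cs.simple i) = reflEnd i) (w : W) (x : ℤ) :
    ρ w (-1 - x) = -1 - ρ w x := by
  obtain ⟨ω, rfl⟩ := cs.wordProd_surjective w
  rw [action_wordProd cs hρ, action_wordProd cs hρ]
  induction ω generalizing x with
  | nil => rfl
  | cons i ω ih =>
    change reflRoot i (actWord ω _) = -1 - reflRoot i (actWord ω x)
    rw [ih, reflRoot_neg]

/-- The length of `w` bounds the number of positive roots made negative by `w`. -/
theorem card_inversions_le_length (hρ : ∀ i, ρ (cs.simple i) = reflEnd i) (w : W)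
    (F : Finset ℤ) (hF : ∀ x ∈ F, 0 ≤ x ∧ ρ w x < 0) : F.card ≤ cs.length w := by
  obtain ⟨ω, hω, rfl⟩ := cs.exists_isReduced w
  rw [hω.eq]
  clear hω
  induction ω generalizing F with
  | nil =>
    have : F = ∅ := by
      refine Finset.eq_empty_of_forall_notMem fun x hx => ?_
      have := hF x hx
      rw [action_wordProd cs hρ] at this
      exact absurd this.2 (not_lt.mpr this.1)
    simp [this]
  | cons i ω ih =>
    classical
    have h1 := ih (F.filter fun x => ρ (cs.wordProd ω) x < 0) (fun x hx => by
      rw [Finset.mem_filter] at hx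
      exact ⟨(hF x hx.1).1, hx.2⟩)
    have h2 : (F.filter fun x => ¬ ρ (cs.wordProd ω) x < 0).card ≤ 1 := by
      have key : ∀ a ∈ F.filter fun x => ¬ ρ (cs.wordProd ω) x < 0,
          ρ (cs.wordProd ω) a = simpleRoot i := by
        intro a ha
        rw [Finset.mem_filter] at ha
        refine reflRoot_neg_iff i (not_lt.mp ha.2) ?_
        have := (hF a ha.1).2
        rwa [cs.wordProd_cons, action_simple_mul cs hρ] at this
      rw [Finset.card_le_one]
      intro a ha b hb
      exact action_injective (ρ := ρ) _ ((key a ha).trans (key b hb).symm)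
    have h3 := Finset.card_filter_add_card_filter_not (s := F)
      (fun x => ρ (cs.wordProd ω) x < 0)
    rw [List.length_cons]
    omega

theorem simple_mem_parabolic {σ : Finset (Fin 5)} {i : Fin 5} (hi : i ∈ σ) :
    cs.simple i ∈ parabolic cs σ :=
  Subgroup.subset_closure ⟨i, hi, rfl⟩

theorem wordProd_mem_parabolic {σ : Finset (Fin 5)} {ω : List (Fin 5)} (h : ∀ i ∈ ω, i ∈ σ) :
    cs.wordProd ω ∈ parabolic cs σ := by
  induction ω with
  | nil => rw [cs.wordProd_nil]; exact one_mem _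
  | cons i ω ih =>
    rw [cs.wordProd_cons]
    exact mul_mem (simple_mem_parabolic cs (h i (by simp)))
      (ih fun j hj => h j (by simp [hj]))

theorem parabolic_induction {σ : Finset (Fin 5)} {p : W → Prop} (one : p 1)
    (mul : ∀ i ∈ σ, ∀ w, p w → p (cs.simple i * w)) {w : W} (hw : w ∈ parabolic cs σ) : p w := by
  refine Subgroup.closure_induction_left (p := fun w _ => p w) one ?_ ?_ hw
  · rintro _ ⟨i, hi, rfl⟩ y _ hy
    exact mul i hi y hy
  · rintro _ ⟨i, hi, rfl⟩ y _ hy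
    rw [cs.inv_simple]
    exact mul i hi y hy

theorem action_mem_roots (hρ : ∀ i, ρ (cs.simple i) = reflEnd i) {σ : Finset (Fin 5)}
    {Q : List ℤ} (hQ : rootsStable σ Q) {w : W} (hw : w ∈ parabolic cs σ) {x : ℤ} (hx : x ∈ Q) :
    ρ w x ∈ Q ∨ -1 - ρ w x ∈ Q := by
  refine parabolic_induction cs (p := fun w => ρ w x ∈ Q ∨ -1 - ρ w x ∈ Q) ?_ ?_ hw
  · rw [action_one]; exact Or.inl hx
  · intro i hi w h
    rw [action_simple_mul cs hρ]
    rcases h with h | h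
    · exact (hQ.2 i hi).2 _ h
    · have := (hQ.2 i hi).2 _ h
      rw [reflRoot_neg] at this
      rcases this with h | h
      · exact Or.inr h
      · left; convert h using 1; ring

theorem action_notMem_roots (hρ : ∀ i, ρ (cs.simple i) = reflEnd i) {σ : Finset (Fin 5)}
    {Q : List ℤ} (hQ : rootsStable σ Q) {w : W} (hw : w ∈ parabolic cs σ) {x : ℤ} (hx0 : 0 ≤ x)
    (hx : x ∉ Q) : 0 ≤ ρ w x ∧ ρ w x ∉ Q := by
  refine parabolic_induction cs (p := fun w => 0 ≤ ρ w x ∧ ρ w x ∉ Q) ?_ ?_ hw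
  · rw [action_one]; exact ⟨hx0, hx⟩
  · intro i hi w h
    rw [action_simple_mul cs hρ]
    have invol : reflRoot i (reflRoot i (ρ w x)) = ρ w x := by
      rw [← action_simple_mul cs hρ, ← action_simple_mul cs hρ, cs.simple_mul_simple_cancel_left]
    refine ⟨?_, fun h' => ?_⟩
    · by_contra hneg
      have := reflRoot_neg_iff i h.1 (not_le.mp hneg)
      exact h.2 (this ▸ (hQ.2 i hi).1)
    · have := (hQ.2 i hi).2 _ h'
      rw [invol] at this
      rcases this with h1 | h1
      · exact h.2 h1
      · have := hQ.1 _ h1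
        have := h.1
        omega

/-- `σ` generates a finite parabolic subgroup, with given Poincaré polynomial, whose elements
have as many inversions as their length. -/
structure ParabolicFacts (ρ : W →* Function.End ℤ) (σ : Finset (Fin 5)) (l : List ℤ) :
    Prop where
  finite : (parabolic cs σ : Set W).Finite
  poin_eq : poin cs σ = listPoly l
  inversions : ∀ w ∈ parabolic cs σ, ∃ F : Finset ℤ,
    (∀ x ∈ F, 0 ≤ x ∧ ρ w x < 0) ∧ F.card = cs.length w

theorem poin_eq_sum {σ : Finset (Fin 5)} {s : Finset W} (hs : (s : Set W) = parabolic cs σ) :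
    poin cs σ = ∑ w ∈ s, X ^ cs.length w := by
  have hfin : (parabolic cs σ : Set W).Finite := hs ▸ s.finite_toSet
  unfold poin
  rw [dif_pos hfin]
  refine Finset.sum_congr ?_ fun _ _ => rfl
  ext w
  rw [Set.Finite.mem_toFinset, ← hs, Finset.mem_coe]

theorem parabolicFacts_empty : ParabolicFacts cs ρ ∅ [1] := by
  have h : ((({1} : Finset W)) : Set W) = parabolic cs (∅ : Finset (Fin 5)) := by
    simp [parabolic]
  refine ⟨h ▸ Finset.finite_toSet _, ?_, ?_⟩
  · rw [poin_eq_sum cs h]; simp [listPoly]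
  · intro w hw
    have : w = 1 := by
      have : w ∈ (parabolic cs (∅ : Finset (Fin 5)) : Set W) := hw
      rw [← h] at this
      simpa using this
    exact ⟨∅, by simp, by simp [this]⟩

theorem listPoly_monomial (n : ℕ) : listPoly (List.replicate n 0 ++ [1]) = X ^ n := by
  induction n with
  | zero => simp [listPoly]
  | succ n ih =>
    rw [List.replicate_succ, List.cons_append, listPoly, ih, pow_succ]; simp; ring

theorem listPoly_foldr {α : Type*} (f : α → List ℤ) (X : List α) :
    listPoly (X.foldr (fun a l => listAdd (f a) l) []) = (X.map fun a => listPoly (f a)).sum := by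
  induction X with
  | nil => rfl
  | cons a X ih => rw [List.foldr_cons, listPoly_add, ih, List.map_cons, List.sum_cons]

/-- Length is additive on products of a coset representative and an element of `W_τ`. -/
theorem inversions_mul (hρ : ∀ i, ρ (cs.simple i) = reflEnd i) {τ : Finset (Fin 5)}
    {Q Q' : List ℤ} (hQ' : rootsStable τ Q') {l : List ℤ} (hτ : ParabolicFacts cs ρ τ l)
    {ω : List (Fin 5)} (hQ : Q.Nodup) (hpos : ∀ x ∈ Q, 0 ≤ x) (h1 : ∀ x ∈ Q', 0 ≤ actWord ω x)
    (h2 : ω.length ≤ (Q.filter fun x => x ∉ Q' ∧ actWord ω x < 0).length)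
    {w : W} (hw : w ∈ parabolic cs τ) :
    cs.length (cs.wordProd ω * w) = ω.length + cs.length w ∧
      ∃ F : Finset ℤ, (∀ x ∈ F, 0 ≤ x ∧ ρ (cs.wordProd ω * w) x < 0) ∧
        F.card = cs.length (cs.wordProd ω * w) := by
  classical
  obtain ⟨F, hF, hFc⟩ := hτ.inversions w hw
  set G : Finset ℤ := (Q.filter fun x => x ∉ Q' ∧ actWord ω x < 0).toFinset with hG
  have hGc : ω.length ≤ G.card := by
    rw [hG, List.toFinset_card_of_nodup (hQ.filter _)]; exact h2
  have hGm : ∀ x ∈ G, 0 ≤ x ∧ x ∉ Q' ∧ actWord ω x < 0 := by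
    intro x hx
    rw [hG, List.mem_toFinset, List.mem_filter] at hx
    exact ⟨hpos x hx.1, by simpa using hx.2⟩
  set G' : Finset ℤ := G.image (fun x => (ρ w⁻¹ : ℤ → ℤ) x) with hG'
  have hGc' : G'.card = G.card := Finset.card_image_of_injective _ (action_injective w⁻¹)
  have hGm' : ∀ x ∈ G', 0 ≤ x ∧ 0 ≤ ρ w x ∧ actWord ω (ρ w x) < 0 := by
    intro x hx
    rw [hG', Finset.mem_image] at hx
    obtain ⟨y, hy, rfl⟩ := hx
    have := hGm y hy
    rw [action_inv_self]
    exact ⟨(action_notMem_roots cs hρ hQ' (inv_mem hw) this.1 this.2.1).1, this.1, this.2.2⟩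
  have hdisj : Disjoint F G' := by
    rw [Finset.disjoint_left]
    intro x hx hx'
    exact absurd (hF x hx).2 (not_lt.mpr (hGm' x hx').2.1)
  have hU : ∀ x ∈ F ∪ G', 0 ≤ x ∧ ρ (cs.wordProd ω * w) x < 0 := by
    intro x hx
    rw [action_mul, action_wordProd cs hρ]
    rcases Finset.mem_union.mp hx with hx | hx
    · have hx := hF x hx
      refine ⟨hx.1, ?_⟩
      have hxQ : x ∈ Q' := by
        by_contra hxQ
        exact absurd hx.2 (not_lt.mpr (action_notMem_roots cs hρ hQ' hw hx.1 hxQ).1)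
      rcases action_mem_roots cs hρ hQ' hw hxQ with h | h
      · exact absurd hx.2 (not_lt.mpr (hQ'.1 _ h))
      · have := h1 _ h
        rw [← action_wordProd cs hρ, action_neg cs hρ, action_wordProd cs hρ] at this
        omega
    · exact ⟨(hGm' x hx).1, (hGm' x hx).2.2⟩
  have hle := card_inversions_le_length cs hρ _ _ hU
  have hcard : (F ∪ G').card = F.card + G'.card := Finset.card_union_of_disjoint hdisj
  have hmul := cs.length_mul_le (cs.wordProd ω) w
  have hword := cs.length_wordProd_le ω
  refine ⟨by omega, F ∪ G', hU, by omega⟩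

theorem parabolicFacts_step (hM : ∀ i j, Mat.M i j = coxF4 i j)
    (hρ : ∀ i, ρ (cs.simple i) = reflEnd i) {σ τ : Finset (Fin 5)} (hτσ : τ ⊆ σ)
    {Q Q' : List ℤ} (hQ' : rootsStable τ Q') {l : List ℤ} (hτ : ParabolicFacts cs ρ τ l)
    {X : List (List (Fin 5) × List (List ℕ))} (hX : repsValid σ τ Q Q' X)
    {k : List ℤ} (hk : listEq k (listMul (X.foldr
      (fun ω l => listAdd (List.replicate ω.1.length 0 ++ [1]) l) []) l) = true) :
    ParabolicFacts cs ρ σ k := by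
  classical
  obtain ⟨hQ, hpos, hnil, hnodup, hrep⟩ := hX
  have hinv : ∀ ω ∈ X, ∀ w ∈ parabolic cs τ, _ := fun ω hω w hw =>
    inversions_mul cs hρ hQ' hτ hQ hpos (hrep ω hω).2.1 (hrep ω hω).2.2.1 hw
  have hmono : parabolic cs τ ≤ parabolic cs σ :=
    Subgroup.closure_mono (Set.image_mono (by exact_mod_cast hτσ))
  have hdec : ∀ w ∈ parabolic cs σ, ∃ ω ∈ X, ∃ v ∈ parabolic cs τ,
      w = cs.wordProd ω.1 * v := by
    intro w hw
    refine parabolic_induction cs (p := fun w => ∃ ω ∈ X, ∃ v ∈ parabolic cs τ,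
      w = cs.wordProd ω.1 * v) ?_ ?_ hw
    · obtain ⟨ω, hω, hω'⟩ := List.mem_map.mp hnil
      exact ⟨ω, hω, 1, one_mem _, by simp [hω']⟩
    · rintro i hi _ ⟨ω, hω, v, hv, rfl⟩
      obtain ⟨ps, -, h⟩ := (hrep ω hω).2.2.2 i hi
      have e := wordProd_moves cs hM ps (i :: ω.1)
      rw [cs.wordProd_cons] at e
      rw [← mul_assoc, ← e]
      rcases h with h | ⟨t, ht, h⟩
      · obtain ⟨ω', hω', h'⟩ := List.mem_map.mp h
        exact ⟨ω', hω', v, hv, by rw [h']⟩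
      · refine ⟨ω, hω, cs.simple t * v, mul_mem (simple_mem_parabolic cs ht) hv, ?_⟩
        rw [h, cs.wordProd_append, cs.wordProd_singleton, mul_assoc]
  have hmem : ∀ ω ∈ X, ∀ v ∈ parabolic cs τ, cs.wordProd ω.1 * v ∈ parabolic cs σ :=
    fun ω hω v hv => mul_mem (wordProd_mem_parabolic cs (hrep ω hω).1) (hmono hv)
  have hwordinj : ∀ ω ∈ X, ∀ ω' ∈ X, cs.wordProd ω.1 = cs.wordProd ω'.1 → ω = ω' := by
    intro ω hω ω' hω' h
    refine List.inj_on_of_nodup_map hnodup hω hω' ?_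
    refine List.map_congr_left fun k _ => ?_
    rw [← action_wordProd cs hρ, ← action_wordProd cs hρ, h]
  have hlen : ∀ ω ∈ X, cs.length (cs.wordProd ω.1) = ω.1.length := by
    intro ω hω
    simpa using (hinv ω hω 1 (one_mem _)).1
  have hinj : ∀ ω ∈ X, ∀ ω' ∈ X, ∀ v ∈ parabolic cs τ, ∀ v' ∈ parabolic cs τ,
      cs.wordProd ω.1 * v = cs.wordProd ω'.1 * v' → ω = ω' ∧ v = v' := by
    intro ω hω ω' hω' v hv v' hv' h
    have e1 : cs.wordProd ω'.1 = cs.wordProd ω.1 * (v * v'⁻¹) := by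
      rw [← mul_assoc, h, mul_inv_cancel_right]
    have e2 : cs.wordProd ω.1 = cs.wordProd ω'.1 * (v' * v⁻¹) := by
      rw [← mul_assoc, ← h, mul_inv_cancel_right]
    have l1 := (hinv ω hω _ (mul_mem hv (inv_mem hv'))).1
    have l2 := (hinv ω' hω' _ (mul_mem hv' (inv_mem hv))).1
    rw [← e1, hlen ω' hω'] at l1
    rw [← e2, hlen ω hω] at l2
    have : cs.length (v * v'⁻¹) = 0 := by omega
    rw [cs.length_eq_zero_iff] at this
    refine ⟨hwordinj ω hω ω' hω' ?_, mul_inv_eq_one.mp this⟩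
    rw [e1, this, mul_one]
  have hXnodup : X.Nodup := List.Nodup.of_map _ hnodup
  set T : Finset W := hτ.finite.toFinset with hT
  have hTm : ∀ v, v ∈ T ↔ v ∈ parabolic cs τ := fun v => by
    rw [hT, Set.Finite.mem_toFinset, SetLike.mem_coe]
  set S : Finset W := (X.toFinset ×ˢ T).image fun p => cs.wordProd p.1.1 * p.2 with hS
  have hSσ : (S : Set W) = parabolic cs σ := by
    ext w
    rw [Finset.mem_coe, SetLike.mem_coe, hS, Finset.mem_image]
    constructor
    · rintro ⟨⟨ω, v⟩, hp, rfl⟩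
      rw [Finset.mem_product, List.mem_toFinset, hTm] at hp
      exact hmem ω hp.1 v hp.2
    · intro hw
      obtain ⟨ω, hω, v, hv, rfl⟩ := hdec w hw
      exact ⟨(ω, v), Finset.mem_product.mpr ⟨List.mem_toFinset.mpr hω, (hTm v).mpr hv⟩, rfl⟩
  refine ⟨hSσ ▸ S.finite_toSet, ?_, ?_⟩
  · have hTp : poin cs τ = ∑ w ∈ T, Polynomial.X ^ cs.length w :=
      poin_eq_sum cs (by rw [hT, Set.Finite.coe_toFinset])
    have hXs : listPoly (X.foldr
        (fun ω l => listAdd (List.replicate ω.1.length 0 ++ [1]) l) []) =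
        ∑ ω ∈ X.toFinset, Polynomial.X ^ ω.1.length := by
      rw [listPoly_foldr, List.sum_toFinset _ hXnodup]
      simp only [listPoly_monomial]
    rw [listPoly_eq hk, listPoly_mul, hXs, ← hτ.poin_eq, hTp, poin_eq_sum cs hSσ, hS,
      Finset.sum_image, Finset.sum_product, Finset.sum_mul_sum]
    · refine Finset.sum_congr rfl fun ω hω => Finset.sum_congr rfl fun v hv => ?_
      rw [List.mem_toFinset] at hω
      rw [(hinv ω hω v ((hTm v).mp hv)).1, pow_add]
    · rintro ⟨ω, v⟩ hp ⟨ω', v'⟩ hp' h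
      rw [Finset.mem_coe, Finset.mem_product, List.mem_toFinset, hTm] at hp hp'
      obtain ⟨h1, h2⟩ := hinj ω hp.1 ω' hp'.1 v hp.2 v' hp'.2 h
      rw [h1, h2]
  · intro w hw
    obtain ⟨ω, hω, v, hv, rfl⟩ := hdec w hw
    exact (hinv ω hω v hv).2

theorem parabolicFacts (hM : ∀ i j, Mat.M i j = coxF4 i j)
    (hρ : ∀ i, ρ (cs.simple i) = reflEnd i) {σ : Finset (Fin 5)} (hσ : σ ≠ Finset.univ) :
    ParabolicFacts cs ρ σ (parabolicData σ).poly := by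
  induction h : σ.card generalizing σ with
  | zero =>
    rw [Finset.card_eq_zero] at h
    subst h
    exact parabolicFacts_empty cs
  | succ n ih =>
    have hne : σ ≠ ∅ := by rintro rfl; simp at h
    obtain ⟨hnode, hreps, hpoly⟩ := repsValid_parabolicData σ hσ hne
    have hσ' : σ.erase (parabolicData σ).node ≠ Finset.univ := fun h' =>
      Finset.notMem_erase (parabolicData σ).node σ (h' ▸ Finset.mem_univ _)
    exact parabolicFacts_step cs hM hρ (Finset.erase_subset _ _)
      (rootsStable_parabolicData _ hσ') (ih hσ' (by rw [Finset.card_erase_of_mem hnode, h]; rfl))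
      hreps hpoly

theorem infinite_parabolic_univ (hρ : ∀ i, ρ (cs.simple i) = reflEnd i) :
    ¬ (parabolic cs (Finset.univ : Finset (Fin 5)) : Set W).Finite := by
  intro hfin
  set ω : List (Fin 5) :=
    [0, 1, 2, 3, 4, 0, 1, 2, 3, 4, 0, 1, 2, 3, 4, 0, 1, 2, 3, 4, 0, 1, 2, 3, 4, 0, 1, 2, 3, 4]
  have h0 : ∃ c : ℤ, c ≠ 0 ∧ actWord ω 0 = 0 + 48 * c := ⟨-1, by norm_num, by decide +kernel⟩
  obtain ⟨c, hc, h0⟩ := h0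
  have hpow : ∀ n : ℕ, ρ (cs.wordProd ω ^ n) 0 = 48 * (n * c) := by
    intro n
    induction n with
    | zero => rw [pow_zero, action_one]; simp
    | succ n ih =>
      rw [pow_succ', action_mul, ih, action_wordProd cs hρ,
        show (48 * (n * c) : ℤ) = 0 + 48 * (n * c) by ring, actWord_add, h0]
      push_cast; ring
  have hinj : Function.Injective fun n : ℕ => cs.wordProd ω ^ n := by
    intro a b h
    have := congrArg (fun w => ρ w 0) h
    simp only [hpow] at this
    have : (a : ℤ) = b := by
      have h' : (a : ℤ) * c = b * c := by linarith
      exact mul_right_cancel₀ hc h'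
    exact_mod_cast this
  refine Set.infinite_of_injective_forall_mem hinj (fun n => ?_) hfin
  exact pow_mem (wordProd_mem_parabolic cs fun i _ => Finset.mem_univ i) n

end Parabolic

/-! ### Homology from certificates -/

/-- The Laurent polynomial with coefficient list `l`. -/
noncomputable def laurentOf (l : List ℤ) : R := Polynomial.toLaurent (listPoly l)

theorem laurentOf_eq {k l : List ℤ} (h : listEq k l = true) : laurentOf k = laurentOf l := by
  rw [laurentOf, laurentOf, listPoly_eq h]

theorem laurentOf_add (k l : List ℤ) : laurentOf (listAdd k l) = laurentOf k + laurentOf l := by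
  simp only [laurentOf, listPoly_add, map_add]

theorem laurentOf_mul (k l : List ℤ) : laurentOf (listMul k l) = laurentOf k * laurentOf l := by
  simp only [laurentOf, listPoly_mul, map_mul]

theorem laurentOf_nil : laurentOf [] = 0 := by
  simp [laurentOf, listPoly]

theorem listPoly_ne_zero {l : List ℤ} (h : l.headD 0 ≠ 0) : listPoly l ≠ 0 := by
  cases l with
  | nil => simp at h
  | cons a l =>
    intro h0
    have := congrArg (fun p : ℚ[X] => p.coeff 0) h0
    simp [listPoly] at this
    exact h (by simpa using this)

theorem laurentOf_ne_zero {l : List ℤ} (h : l.headD 0 ≠ 0) : laurentOf l ≠ 0 := by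
  rw [laurentOf, Polynomial.toLaurent_ne_zero]
  exact listPoly_ne_zero h

theorem isUnit_laurentOf_singleton {e : ℤ} (he : e ≠ 0) : IsUnit (laurentOf [e]) := by
  have : laurentOf [e] = algebraMap ℚ R (e : ℚ) := by
    simp [laurentOf, listPoly]
  rw [this]
  exact (IsUnit.mk0 (e : ℚ) (by exact_mod_cast he)).map _

/-- A matrix of integer polynomials, given by the coefficient lists of its entries. -/
abbrev PolyTable := List (List (List ℤ))

/-- An entry of a matrix of polynomials. -/
def PolyTable.entry (t : PolyTable) (i j : ℕ) : List ℤ := (t.getD i []).getD j []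

/-- An entry of the product of two matrices of polynomials, with inner dimension `n`. -/
def PolyTable.mulEntry (n : ℕ) (t u : PolyTable) (i j : ℕ) : List ℤ :=
  (List.range n).foldr (fun k acc => listAdd (listMul (t.entry i k) (u.entry k j)) acc) []

/-- The `n × m` matrix over `R` described by a table. -/
noncomputable def PolyTable.toMatrix (n m : ℕ) (t : PolyTable) : Matrix (Fin n) (Fin m) R :=
  Matrix.of fun i j => laurentOf (t.entry i j)

theorem PolyTable.mul_apply {l n m : ℕ} (t u : PolyTable) (i : Fin l) (j : Fin m) :
    (t.toMatrix l n * u.toMatrix n m) i j = laurentOf (t.mulEntry n u i j) := by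
  have key : ∀ L : List ℕ, laurentOf
      (L.foldr (fun k acc => listAdd (listMul (t.entry i k) (u.entry k j)) acc) []) =
      (L.map fun k => laurentOf (t.entry i k) * laurentOf (u.entry k j)).sum := by
    intro L
    induction L with
    | nil => simp [laurentOf_nil]
    | cons a L ih => simp [laurentOf_add, laurentOf_mul, ih]
  rw [Matrix.mul_apply, PolyTable.mulEntry, key]
  exact Fin.sum_univ_eq_sum_range
    (fun k => laurentOf (t.entry i k) * laurentOf (u.entry k j)) n

/-- A certificate computing the homology at the middle of a pair of composable matrices. -/
structure HomologyCert where
  /-- a nonzero integer by which rational matrices have been scaled -/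
  scale : ℤ
  /-- a common denominator for the complement of the cycles -/
  den : List ℤ
  /-- the map from chains to the torsion module -/
  φ : PolyTable
  /-- representing cycles of the generators -/
  ψ : PolyTable
  /-- chains bounding the relations -/
  X : PolyTable
  /-- coefficients of boundaries with respect to the relations -/
  Y : PolyTable
  /-- part of a contracting homotopy -/
  U : PolyTable
  /-- part of a contracting homotopy -/
  V : PolyTable

/-- The identities showing that the homology of `R^m → R^n → R^l` with matrices `A` and `B`
is the sum of the cyclic modules with relations `d`. -/
structure HomologyCert.Valid (K : HomologyCert) (l n m : ℕ) (B A : PolyTable)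
    (d : List (List ℤ)) : Prop where
  scale_ne : K.scale ≠ 0
  den_ne : K.den.headD 0 ≠ 0
  cycle : ∀ i < l, ∀ j < d.length, listEq (B.mulEntry n K.ψ i j) [] = true
  boundary : ∀ i < d.length, ∀ j < m,
    listEq (K.φ.mulEntry n A i j) (listMul (d.getD i []) (K.Y.entry i j)) = true
  relation : ∀ i < n, ∀ j < d.length,
    listEq (listMul (K.ψ.entry i j) (d.getD j [])) (A.mulEntry m K.X i j) = true
  retract : ∀ i < d.length, ∀ j < d.length,
    listEq (K.φ.mulEntry n K.ψ i j) (if i = j then [K.scale] else []) = true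
  homotopy : ∀ i < n, ∀ j < n,
    listEq (listMul K.den (if i = j then [K.scale] else []))
      (listAdd (listMul K.den
        (listAdd (K.ψ.mulEntry d.length K.φ i j) (A.mulEntry m K.U i j)))
        (K.V.mulEntry l B i j)) = true

/-- The sum of the cyclic modules `R/(d_i)`. -/
abbrev TorsionModule (d : List (List ℤ)) :=
  (i : Fin d.length) → R ⧸ Ideal.span {laurentOf (d.getD i [])}

/-- The map to a sum of cyclic modules induced by a matrix. -/
noncomputable def torsionMap {n : ℕ} (d : List (List ℤ)) (φ : Matrix (Fin d.length) (Fin n) R) :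
    (Fin n → R) →ₗ[R] TorsionModule d :=
  LinearMap.pi fun i =>
    (Ideal.span {laurentOf (d.getD i [])}).mkQ ∘ₗ LinearMap.proj i ∘ₗ φ.mulVecLin

theorem torsionMap_apply_eq_iff {n : ℕ} (d : List (List ℤ))
    (φ : Matrix (Fin d.length) (Fin n) R) (z : Fin n → R) (y : Fin d.length → R) :
    (torsionMap d φ z = fun i => Submodule.Quotient.mk (y i)) ↔
      ∃ x : Fin d.length → R, ∀ i, (φ.mulVec z) i = y i + laurentOf (d.getD i []) * x i := by
  rw [funext_iff, ← Classical.skolem (p := fun i x =>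
    (φ.mulVec z) i = y i + laurentOf (d.getD i []) * x)]
  refine forall_congr' fun i => ?_
  change Submodule.Quotient.mk ((φ.mulVec z) i) = _ ↔ _
  rw [Submodule.Quotient.eq, Ideal.mem_span_singleton]
  refine exists_congr fun x => ?_
  rw [sub_eq_iff_eq_add']

namespace HomologyCert.Valid

variable {K : HomologyCert} {l n m : ℕ} {B A : PolyTable} {d : List (List ℤ)}

theorem cycle_mul (h : K.Valid l n m B A d) :
    B.toMatrix l n * K.ψ.toMatrix n d.length = 0 := by
  ext i j
  rw [PolyTable.mul_apply, laurentOf_eq (h.cycle i i.2 j j.2), laurentOf_nil, Matrix.zero_apply]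

theorem boundary_mul (h : K.Valid l n m B A d) :
    K.φ.toMatrix d.length n * A.toMatrix n m =
      Matrix.diagonal (fun i : Fin d.length => laurentOf (d.getD i [])) *
        K.Y.toMatrix d.length m := by
  ext i j
  rw [PolyTable.mul_apply, laurentOf_eq (h.boundary i i.2 j j.2), Matrix.diagonal_mul,
    laurentOf_mul]
  rfl

theorem relation_mul (h : K.Valid l n m B A d) :
    K.ψ.toMatrix n d.length * Matrix.diagonal (fun i : Fin d.length => laurentOf (d.getD i [])) =
      A.toMatrix n m * K.X.toMatrix m d.length := by
  ext i j
  rw [PolyTable.mul_apply, ← laurentOf_eq (h.relation i i.2 j j.2), Matrix.mul_diagonal,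
    laurentOf_mul]
  rfl

theorem laurentOf_ite {n : ℕ} (i j : Fin n) (e : ℤ) :
    laurentOf (if (i : ℕ) = j then [e] else []) =
      (laurentOf [e] • (1 : Matrix (Fin n) (Fin n) R)) i j := by
  by_cases hij : i = j
  · simp [hij]
  · rw [if_neg fun h' => hij (Fin.ext h'), Matrix.smul_apply, Matrix.one_apply_ne hij, smul_zero,
      laurentOf_nil]

theorem retract_mul (h : K.Valid l n m B A d) :
    K.φ.toMatrix d.length n * K.ψ.toMatrix n d.length = laurentOf [K.scale] • 1 := by
  ext i j
  rw [PolyTable.mul_apply, laurentOf_eq (h.retract i i.2 j j.2), laurentOf_ite]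

theorem homotopy_mul (h : K.Valid l n m B A d) :
    laurentOf K.den • laurentOf [K.scale] • (1 : Matrix (Fin n) (Fin n) R) =
      laurentOf K.den • (K.ψ.toMatrix n d.length * K.φ.toMatrix d.length n +
        A.toMatrix n m * K.U.toMatrix m n) + K.V.toMatrix n l * B.toMatrix l n := by
  ext i j
  rw [Matrix.smul_apply, ← laurentOf_ite, smul_eq_mul, ← laurentOf_mul,
    laurentOf_eq (h.homotopy i i.2 j j.2), laurentOf_add, laurentOf_mul, laurentOf_add,
    Matrix.add_apply, Matrix.smul_apply, Matrix.add_apply, PolyTable.mul_apply,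
    PolyTable.mul_apply, PolyTable.mul_apply, smul_eq_mul]

theorem smul_cycle (h : K.Valid l n m B A d) {z : Fin n → R}
    (hz : (B.toMatrix l n).mulVec z = 0) :
    laurentOf [K.scale] • z =
      (K.ψ.toMatrix n d.length).mulVec ((K.φ.toMatrix d.length n).mulVec z) +
        (A.toMatrix n m).mulVec ((K.U.toMatrix m n).mulVec z) := by
  have := congrArg (fun T : Matrix (Fin n) (Fin n) R => T.mulVec z) h.homotopy_mul
  simp only [Matrix.smul_mulVec, Matrix.add_mulVec, ← Matrix.mulVec_mulVec, hz,
    Matrix.mulVec_zero, add_zero, Matrix.one_mulVec] at this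
  exact smul_right_injective _ (laurentOf_ne_zero h.den_ne) this

theorem surjective (h : K.Valid l n m B A d) (y : TorsionModule d) :
    ∃ z, (B.toMatrix l n).mulVec z = 0 ∧ torsionMap d (K.φ.toMatrix d.length n) z = y := by
  obtain ⟨u, hu⟩ := isUnit_laurentOf_singleton h.scale_ne
  choose y' hy' using fun i => Submodule.Quotient.mk_surjective _ (y i)
  refine ⟨(K.ψ.toMatrix n d.length).mulVec ((↑u⁻¹ : R) • y'), ?_, ?_⟩
  · rw [Matrix.mulVec_mulVec, h.cycle_mul, Matrix.zero_mulVec]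
  · rw [← funext hy', torsionMap_apply_eq_iff]
    refine ⟨0, fun i => ?_⟩
    rw [Matrix.mulVec_mulVec, h.retract_mul, ← hu, Matrix.smul_mulVec, Matrix.one_mulVec,
      smul_smul, Units.mul_inv, one_smul, Pi.zero_apply, mul_zero, add_zero]

theorem torsionMap_eq_zero_iff (h : K.Valid l n m B A d) {z : Fin n → R}
    (hz : (B.toMatrix l n).mulVec z = 0) :
    torsionMap d (K.φ.toMatrix d.length n) z = 0 ↔ ∃ x, (A.toMatrix n m).mulVec x = z := by
  have h0 : (0 : TorsionModule d) = fun i => Submodule.Quotient.mk ((0 : Fin d.length → R) i) :=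
    rfl
  rw [h0, torsionMap_apply_eq_iff]
  constructor
  · rintro ⟨x, hx⟩
    obtain ⟨u, hu⟩ := isUnit_laurentOf_singleton h.scale_ne
    have hx' : (K.φ.toMatrix d.length n).mulVec z =
        (Matrix.diagonal fun i : Fin d.length => laurentOf (d.getD i [])).mulVec x := by
      ext i
      rw [hx, Matrix.mulVec_diagonal, Pi.zero_apply, zero_add]
    have hs := h.smul_cycle hz
    rw [hx', Matrix.mulVec_mulVec, h.relation_mul, ← Matrix.mulVec_mulVec, ← Matrix.mulVec_add,
      ← hu] at hs
    refine ⟨(↑u⁻¹ : R) • ((K.X.toMatrix m d.length).mulVec x + (K.U.toMatrix m n).mulVec z), ?_⟩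
    rw [Matrix.mulVec_smul, ← hs, smul_smul, Units.inv_mul, one_smul]
  · rintro ⟨x, rfl⟩
    refine ⟨(K.Y.toMatrix d.length m).mulVec x, fun i => ?_⟩
    rw [Matrix.mulVec_mulVec, h.boundary_mul, ← Matrix.mulVec_mulVec, Matrix.mulVec_diagonal,
      Pi.zero_apply, zero_add]

end HomologyCert.Valid

theorem nonempty_quotient_equiv {C N : Type*} [AddCommGroup C] [Module R C] [AddCommGroup N]
    [Module R N] (Z D : Submodule R C) (f : C →ₗ[R] N) (hf : ∀ y, ∃ z ∈ Z, f z = y)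
    (hD : ∀ z ∈ Z, f z = 0 ↔ z ∈ D) : Nonempty ((Z ⧸ D.comap Z.subtype) ≃ₗ[R] N) := by
  have hsurj : Function.Surjective (f ∘ₗ Z.subtype) := fun y =>
    let ⟨z, hz, h⟩ := hf y
    ⟨⟨z, hz⟩, h⟩
  refine ⟨(Submodule.quotEquivOfEq _ _ ?_).trans
    ((f ∘ₗ Z.subtype).quotKerEquivOfSurjective hsurj)⟩
  ext z
  exact (hD z z.2).symm

/-! ### The cyclic modules -/

theorem nonempty_quotient_mul_equiv {a b : R} (h : IsCoprime a b) :
    Nonempty ((R ⧸ Ideal.span {a * b}) ≃ₗ[R] (R ⧸ Ideal.span {a}) × (R ⧸ Ideal.span {b})) := by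
  have hc : IsCoprime (Ideal.span {a}) (Ideal.span {b}) :=
    (Ideal.isCoprime_span_singleton_iff a b).2 h
  have he : Ideal.span {a * b} = Ideal.span {a} * Ideal.span {b} :=
    (Ideal.span_singleton_mul_span_singleton a b).symm
  refine ⟨(Submodule.quotEquivOfEq _ _ he).trans
    { (Ideal.quotientMulEquivQuotientProd _ _ hc).toAddEquiv with
      map_smul' := fun r x => ?_ }⟩
  obtain ⟨x, rfl⟩ := Submodule.Quotient.mk_surjective _ x
  rfl

theorem isCoprime_cyc {m n : ℕ} (h : m ≠ n) : IsCoprime (cyc m) (cyc n) :=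
  (Polynomial.cyclotomic.isCoprime_rat h).map (Polynomial.toLaurent : ℚ[X] →+* R)

theorem cyc_two : cyc 2 = laurentOf [1, 1] := by
  rw [cyc, Polynomial.cyclotomic_two, laurentOf]
  congr 1
  simp [listPoly]; ring

theorem cyc_three : cyc 3 = laurentOf [1, 1, 1] := by
  rw [cyc, Polynomial.cyclotomic_three, laurentOf]
  congr 1
  simp [listPoly]; ring

theorem cyc_four : cyc 4 = laurentOf [1, 0, 1] := by
  rw [cyc, show 4 = 2 ^ (1 + 1) by norm_num,
    Polynomial.cyclotomic_prime_pow_eq_geom_sum Nat.prime_two, laurentOf]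
  congr 1
  simp [listPoly, Finset.sum_range_succ]; ring

theorem cyc_eight : cyc 8 = laurentOf [1, 0, 0, 0, 1] := by
  rw [cyc, show 8 = 2 ^ (2 + 1) by norm_num,
    Polynomial.cyclotomic_prime_pow_eq_geom_sum Nat.prime_two, laurentOf]
  congr 1
  simp [listPoly, Finset.sum_range_succ]; ring

theorem nonempty_torsionModule_two : Nonempty (TorsionModule [[1, 1]] ≃ₗ[R] CycQuot 2) := by
  refine ⟨(LinearEquiv.piUnique (α := Fin 1) R _).trans (Submodule.quotEquivOfEq _ _ ?_)⟩
  rw [cyc_two]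
  rfl

theorem nonempty_torsionModule_two_three :
    Nonempty (TorsionModule [[1, 2, 2, 1]] ≃ₗ[R] CycQuot 2 × CycQuot 3) := by
  obtain ⟨f⟩ := nonempty_quotient_mul_equiv (isCoprime_cyc (show 2 ≠ 3 by norm_num))
  refine ⟨(LinearEquiv.piUnique (α := Fin 1) R _).trans
    ((Submodule.quotEquivOfEq _ _ ?_).trans f)⟩
  rw [cyc_two, cyc_three, ← laurentOf_mul]
  rfl

theorem nonempty_torsionModule_two_eight :
    Nonempty (TorsionModule [[1, 1], [1, 2, 3, 3, 3, 3, 3, 3, 2, 1]] ≃ₗ[R]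
      CycQuot 2 × CycQuot 2 × CycQuot 3 × CycQuot 4 × CycQuot 8) := by
  have c23 := isCoprime_cyc (show 2 ≠ 3 by norm_num)
  have c24 := isCoprime_cyc (show 2 ≠ 4 by norm_num)
  have c28 := isCoprime_cyc (show 2 ≠ 8 by norm_num)
  have c34 := isCoprime_cyc (show 3 ≠ 4 by norm_num)
  have c38 := isCoprime_cyc (show 3 ≠ 8 by norm_num)
  have c48 := isCoprime_cyc (show 4 ≠ 8 by norm_num)
  obtain ⟨f⟩ := nonempty_quotient_mul_equiv (c23.mul_right (c24.mul_right c28))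
  obtain ⟨g⟩ := nonempty_quotient_mul_equiv (c34.mul_right c38)
  obtain ⟨h⟩ := nonempty_quotient_mul_equiv c48
  refine ⟨(LinearEquiv.piFinTwo R _).trans (LinearEquiv.prodCongr
    (Submodule.quotEquivOfEq _ _ ?_)
    ((Submodule.quotEquivOfEq _ _ ?_).trans (f.trans (LinearEquiv.prodCongr (.refl R _)
      (g.trans (LinearEquiv.prodCongr (.refl R _) h))))))⟩
  · rw [cyc_two]
    rfl
  · rw [cyc_two, cyc_three, cyc_four, cyc_eight, ← laurentOf_mul, ← laurentOf_mul,
      ← laurentOf_mul]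
    exact congrArg (fun a => Ideal.span {a}) (laurentOf_eq (by decide))

theorem nonempty_torsionModule_free : Nonempty (TorsionModule [[]] ≃ₗ[R] R) := by
  refine ⟨(LinearEquiv.piUnique (α := Fin 1) R _).trans (Submodule.quotEquivOfEqBot _ ?_)⟩
  exact (congrArg (fun a => Ideal.span {a}) laurentOf_nil).trans
    (Ideal.span_singleton_eq_bot.2 rfl)

/-! ### The weighted complex of type affine `F₄` -/

/-- The bit masks of the proper subsets of cardinality `k`. -/
def cellMasks (k : ℕ) : List ℕ :=
  ([[0], [1, 2, 4, 8, 16],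
    [3, 5, 9, 17, 6, 10, 18, 12, 20, 24],
    [7, 11, 19, 13, 21, 25, 14, 22, 26, 28], [15, 23, 27, 29, 30]] :
    List (List ℕ)).getD k []

/-- The number of basis elements in degree `k`. -/
def cellCount (k : ℕ) : ℕ := (cellMasks k).length

/-- The `i`-th basis element in degree `k`. -/
def cell (k i : ℕ) : Finset (Fin 5) :=
  Finset.univ.filter fun s => Nat.testBit ((cellMasks k).getD i 0) s

theorem cell_card : ∀ k < 5, ∀ i < cellCount k, (cell k i).card = k ∧ cell k i ≠ Finset.univ := by
  decide +kernel

theorem cell_injective :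
    ∀ k < 5, ∀ i < cellCount k, ∀ j < cellCount k, cell k i = cell k j → i = j := by
  decide +kernel

theorem exists_cell :
    ∀ σ : Finset (Fin 5), σ ≠ Finset.univ → ∃ i < cellCount σ.card, cell σ.card i = σ := by
  decide +kernel

theorem cellCount_eq_zero {k : ℕ} (hk : 5 ≤ k) : cellCount k = 0 := by
  rw [cellCount, cellMasks, List.getD_eq_default _ _ (by simpa using hk)]
  rfl

/-- The matrices of the boundary maps from degree `k + 1` to degree `k`. -/
def boundaryTable (k : ℕ) : PolyTable :=
  [
    [[[1, 1], [1, 1], [1, 1], [1, 1], [1, 1]]],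
    [[[-1, -1, -1], [-1, -1], [-1, -1], [-1, -1], [], [], [], [], [], []], [[1, 1, 1], [], [], [],
    [-1, -1, -1], [-1, -1], [-1, -1], [], [], []], [[], [1, 1], [], [], [1, 1, 1], [], [], [-1,
    -1, -1, -1], [-1, -1], []], [[], [], [1, 1], [], [], [1, 1], [], [1, 1, 1, 1], [], [-1, -1,
    -1]], [[], [], [], [1, 1], [], [], [1, 1], [], [1, 1], [1, 1, 1]]],
    [[[1, 1, 1, 1], [1, 1], [1, 1], [], [], [], [], [], [], []], [[-1, -1, -2, -1, -1], [], [],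
    [1, 1, 1, 1], [1, 1], [], [], [], [], []], [[], [-1, -1, -1], [], [-1, -1, -1, -1], [], [1, 1,
    1], [], [], [], []], [[], [], [-1, -1, -1], [], [-1, -1], [-1, -1, -1], [], [], [], []], [[1,
    1, 1, 1], [], [], [], [], [], [1, 1, 1, 2, 1, 1, 1], [1, 1], [], []], [[], [1, 1, 1], [], [],
    [], [], [-1, -1, -2, -2, -2, -2, -1, -1], [], [1, 1, 1], []], [[], [], [1, 1, 1], [], [], [],
    [], [-1, -1, -1], [-1, -1, -1], []], [[], [], [], [1, 1], [], [], [1, 1, 1, 1, 1, 1], [], [],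
    [1, 1, 1, 1, 1, 1]], [[], [], [], [], [1, 1], [], [], [1, 1, 1], [], [-1, -1, -2, -2, -2, -2,
    -1, -1]], [[], [], [], [], [], [1, 1], [], [], [1, 1], [1, 1, 1, 2, 1, 1, 1]]],
    [[[-1, -1, -1, -2, -2, -2, -2, -2, -1, -1, -1], [-1, -1], [], [], []], [[1, 1, 2, 3, 3, 4, 4,
    4, 3, 3, 2, 1, 1], [], [-1, -1, -1], [], []], [[], [1, 1, 1, 1], [1, 1, 1], [], []], [[-1, -1,
    -2, -2, -3, -3, -3, -3, -2, -2, -1, -1], [], [], [-1, -1, -1, -1, -1, -1], []], [[], [-1, -1,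
    -2, -1, -1], [], [1, 1, 2, 2, 2, 2, 1, 1], []], [[], [], [-1, -1, -1], [-1, -1, -1, -2, -1,
    -1, -1], []], [[1, 1, 1, 1, 1, 1, 1, 1], [], [], [], [-1, -1, -1, -1, -2, -2, -2, -2, -2, -2,
    -2, -2, -1, -1, -1, -1]], [[], [1, 1, 1, 1], [], [], [1, 1, 2, 3, 4, 5, 6, 7, 7, 8, 8, 8, 7,
    7, 6, 5, 4, 3, 2, 1, 1]], [[], [], [1, 1, 1], [], [-1, -1, -2, -3, -4, -5, -6, -7, -7, -8, -8,
    -8, -7, -7, -6, -5, -4, -3, -2, -1, -1]], [[], [], [], [1, 1], [1, 1, 1, 1, 2, 2, 2, 2, 2, 2,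
    2, 2, 1, 1, 1, 1]]]].getD k []

/-- The relations of the homology in degree `k`. -/
def torsion (k : ℕ) : List (List ℤ) :=
  [[[1, 1]], [[1, 1]], [[1, 2, 2, 1]], [[1, 1], [1, 2, 3, 3, 3, 3, 3, 3, 2, 1]], [[]]].getD k []

/-- Certificates for the homology in degree `k`. -/
def homologyCerts : List HomologyCert :=
  [
    { scale := 1
      den := [1]
      φ :=
        [[[1]]]
      ψ :=
        [[[1]]]
      X :=
        [[[1]], [[]], [[]], [[]], [[]]]
      Y :=
        [[[1], [1], [1], [1], [1]]]
      U :=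
        [[[]], [[]], [[]], [[]], [[]]]
      V := [] },
    { scale := 1
      den := [1, 1]
      φ :=
        [[[], [1, 1], [1, 2, 2, 1], [-1, -1, -1], [-1, -2, -3, -2, -1]]]
      ψ :=
        [[[1, 1]], [[0, -1]], [[]], [[-1]], [[]]]
      X :=
        [[[]], [[]], [[-1, -1]], [[]], [[]], [[0, 1]], [[]], [[]], [[]], [[]]]
      Y :=
        [[[1, 1, 1], [1, 2, 2, 1], [-1, -1, -1], [-1, -2, -3, -2, -1], [0, 1, 2, 2, 1], [-2, -2,
        -1], [-2, -3, -3, -2, -1], [-2, -3, -5, -4, -3, -1], [-2, -4, -5, -3, -1], [0, -1, -2, -3,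
        -2, -1]]]
      U :=
        [[[], [1], [1, 1, 1], [0, -1], [0, -1, -1, -1]], [[], [], [0, -1], [], []], [[], [1], [1,
        1, 1], [0, -1], [0, -1, -1, -1]], [[], [], [], [], [0, -1]], [[], [], [1], [], []], [[],
        [], [], [], []], [[], [], [], [], []], [[], [], [], [], []], [[], [], [], [], []], [[],
        [], [], [], [1]]]
      V :=
        [[[1]], [[]], [[]], [[]], [[]]] },
    { scale := 2
      den := [1, 1]
      φ :=
        [[[], [-1, -1, 2, 6, 8, 6, 3, 1], [], [], [0, -1, -1, 2, 6, 8, 6, 3, 1], [], [2, 2], [3,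
        3, 1, -5, -10, -12, -11, -7, -3, -1], [2, 3, 1, -3, -6, -5, -3, -1], []]]
      ψ :=
        [[[]], [[1, 0, 1]], [[-1, -1, -1]], [[0, 1]], [[]], [[0, 1]], [[0, -1]], [[1]], [[]],
        [[]]]
      X :=
        [[[]], [[-1]], [[1]], [[1, 1, 1]], [[]], [[-1, -1, -1]], [[]], [[]], [[1, 1, 1]], [[]]]
      Y :=
        [[[1, -1, -1, -2, -3, -1, -1], [], [2], [2], [1, 1, 1, 1], [], [3, -1, 1, -1, -2, -2, -3,
        -3, -1, -1], [], [-2], [1, -1, -1, -3, -2, -4, -3, -3, -1, -1]]]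
      U :=
        [[[], [-1, -1, -1], [], [], [0, -1, -1, -1], [], [], [1, 1, 2, 1, 1], [0, 1, 1], []], [[0,
        -2], [-1, -1, 0, 1, 1], [0, 2], [0, 2, 2, 2], [0, -1, -1, 0, 1, 1], [2, 2], [2, 2, 2, 2],
        [1, 3, 1, 2, -1, -1, -1], [2, 3, 3, 1, -1], [0, 0, 2, 2, 2]], [[], [], [], [], [], [], [],
        [], [], []], [[], [1, 0, -2, -4, -4, -2, -1], [], [], [0, 1, 0, -2, -4, -4, -2, -1], [],
        [-2], [-1, -2, 1, 4, 6, 6, 5, 2, 1], [-2, -1, 0, 3, 3, 2, 1], []], [[], [1, -1, -1, -3,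
        -1, -1], [], [], [0, 1, -1, -1, -3, -1, -1], [], [], [-1, 1, 0, 4, 2, 4, 1, 1], [0, -1, 1,
        2, 1, 1], []], [[], [-1, 0, 2, 4, 4, 2, 1], [], [-2], [0, -1, 0, 2, 4, 4, 2, 1], [], [],
        [1, 2, -1, -4, -6, -6, -5, -2, -1], [0, 1, 0, -3, -3, -2, -1], [0, -2]], [[], [], [], [],
        [], [], [], [], [], []], [[], [-1, 1, 2, 1, 1], [], [], [0, -1, 1, 2, 1, 1], [], [], [1,
        -1, -1, -2, -3, -1, -1], [2, -1, -1, -1, -1], []], [[], [1, 0, -2, -4, -4, -2, -1], [],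
        [], [0, 1, 0, -2, -4, -4, -2, -1], [], [-2], [-1, -2, 1, 4, 6, 6, 5, 2, 1], [-2, -1, 0, 3,
        3, 2, 1], []], [[], [], [], [], [], [], [], [], [], []]]
      V :=
        [[[], [2, 2], [2, 4, 4, 2], [0, -2, -2], [0, -2, -4, -4, -2]], [[], [], [0, -2, -2], [],
        []], [[], [0, -2, -2], [0, -2, -4, -4, -2], [2, 2, 2, 2], [2, 4, 6, 6, 4, 2]], [[], [],
        [], [], [0, -2, -2]], [[], [], [2, 2], [], []], [[], [0, 2, 2], [0, 2, 4, 4, 2], [0, -2,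
        -2, -2], [0, -2, -4, -6, -4, -2]], [[], [], [], [], []], [[], [], [], [], []], [[], [],
        [], [], []], [[], [], [], [], [2, 2]]] },
    { scale := 2
      den := [1, 2, 2, 1]
      φ :=
        [[[], [], [], [0, 0, 2, 0, 0, 2], [], [], [2, 0, 2, 0, 2, 2, 2, 2, 0, 2], [], [0, 0, -2,
        0, 0, -2], [0, 0, 4, 0, 4, 2, 4, 2, 0, 2]], [[], [], [], [2, 2, 2, 2, 2, 2, 2, 2], [], [],
        [4, 4, 6, 4, 6, 6, 6, 6, 4, 4, 2, 2], [], [-2, -2, -2, -2, -2, -2, -2, -2], [4, 4, 8, 6,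
        10, 8, 10, 8, 6, 4, 2, 2]]]
      ψ :=
        [[[], []], [[1, 1, 3, 2, 2, 2, 2, 2, 1, 2, 0, 1], [0, -1, -1, 1, -2, 0, 0, -2, 1, -1]],
        [[-1, -1, -3, -2, -2, -2, -2, -2, -1, -2, 0, -1], [0, 1, 1, -1, 2, 0, 0, 2, -1, 1]], [[0,
        1, 0, 1, -1, 1, -2, 0, -2, 0, -1], [-1, 0, 0, -1, 1, -1, 2, -1, 1]], [[0, -1, 0, -2, 1,
        -2, 3, -1, 4, 0, 3, 0, 1], [1, 0, 1, 1, -1, 2, -3, 2, -3, 1, -1]], [[1, 2, 3, 3, 2, 2, 1,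
        1], [-1, -1, -1, -1, 0, -1]], [[1, 0, 1, 0, 1, 0, 1], [0, 0, -1, 1, -1]], [[-1, 0, -2, -1,
        -2, -2, -2, -2, -1, -2, 0, -1], [0, 0, 1, -1, 2, 0, 0, 2, -1, 1]], [[0, -1, -1, -1], [0,
        1]], [[-1, -1, -1], [1]]]
      X :=
        [[[1], [0, 0, -1, 0, -1, 0, -1]], [[-1, 0, -1, -1, -1, -1, -1, -1, 0, -1], [0, 0, 1, 0, 2,
        1, 3, 2, 3, 3, 2, 3, 1, 2, 0, 1]], [[0, -1, -1], [0, 1, 1, 1, 1, 1, 1, 1, 1]], [[-1, -1,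
        -1], [1, 1, 2, 1, 2, 1, 2, 1, 1]], [[], []]]
      Y :=
        [[[2, 0, 2, 0, 2, 0, 2], [], [0, 0, -2, 0, -2, 0, -2], [0, 0, 2, 0, 2, 0, 2], [-2, 0, 2,
        0, 4, 4, 10, 8, 16, 12, 20, 16, 24, 16, 22, 16, 20, 12, 14, 8, 8, 4, 4, 0, 2]], [[2], [],
        [-2], [2], [2, 0, 4, 4, 4, 4, 10, 4, 6, 8, 8, 4, 8, 4, 4, 4, 2, 0, 2]]]
      U :=
        [[[], [], [], [], [], [], [], [], [], []], [[-1, 2, 0, 1], [], [], [], [-1], [], [1, 0, 2,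
        0, 2, 0, 1], [], [], [1, 0, 2, 0, 2, 0, 1]], [[], [], [], [-2], [], [], [-2, 0, -2, 0,
        -2], [], [2], [-2, -2, -2, 0, -2]], [[], [], [], [-2], [], [], [-2, 0, -2, 0, -2], [],
        [2], [-2, -2, -2, 0, -2]], [[], [], [], [], [], [], [], [], [], []]]
      V :=
        [[[], [-1, -3, -5, -5, -3, -1], [], [], [0, -1, -3, -5, -5, -3, -1], [], [], [1, 3, 6, 8,
        8, 6, 3, 1], [0, 1, 3, 4, 3, 1], []], [[0, -2, -4, -4, -2], [0, -2, -6, -8, -6, -2], [0,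
        2, 4, 4, 2], [0, 2, 6, 10, 10, 6, 2], [0, 0, -2, -6, -8, -6, -2], [2, 6, 8, 6, 2], [0, 4,
        10, 12, 10, 6, 2], [-2, 2, 8, 16, 18, 14, 8, 2], [0, 4, 12, 18, 16, 8, 2], [0, 0, 2, 6,
        10, 10, 6, 2]], [[], [-1, -1, 2, 6, 8, 6, 3, 1], [], [], [0, -1, -1, 2, 6, 8, 6, 3, 1],
        [], [2, 2], [3, 3, 1, -5, -10, -12, -11, -7, -3, -1], [2, 3, 1, -3, -6, -5, -3, -1], []],
        [[], [], [], [], [], [], [], [2, 2, 2], [], []], [[], [1, 1, -1, -6, -10, -10, -7, -3,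
        -1], [], [], [0, 1, 1, -1, -6, -10, -10, -7, -3, -1], [], [], [-1, -1, 0, 5, 11, 16, 17,
        13, 8, 3, 1], [0, -1, -1, 2, 6, 8, 6, 3, 1], []], [[], [], [], [-2, -4, -4, -2], [], [],
        [-2, -4, -4, -2], [-2, -2, -2], [-2, -4, -4, -2], [0, -2, -4, -4, -2]], [[], [], [], [],
        [], [], [], [], [], []], [[], [-1, -1, 2, 6, 8, 6, 3, 1], [], [], [0, -1, -1, 2, 6, 8, 6,
        3, 1], [], [], [1, 1, -1, -5, -10, -12, -11, -7, -3, -1], [2, 3, 1, -3, -6, -5, -3, -1],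
        []], [[], [], [], [], [], [], [], [2, 2, 2], [], []], [[], [], [], [], [], [], [], [], [],
        []]] },
    { scale := 2
      den := [1, 2, 3, 3, 3, 3, 3, 3, 2, 1]
      φ :=
        [[[], [], [], [], [2]]]
      ψ :=
        [[[1, 0, 0, 0, 1, 0, 0, 0, 1]], [[-1, 0, -1, -1, -2, -1, -2, -2, -2, -2, -2, -2, -1, -2,
        -1, -1, 0, -1]], [[1, 0, 1, 2, 1, 2, 3, 2, 2, 4, 2, 2, 3, 2, 1, 2, 1, 0, 1]], [[-1, 0, -1,
        0, -2, 0, -2, 0, -2, 0, -2, 0, -1, 0, -1]], [[1]]]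
      X := []
      Y := []
      U := []
      V :=
        [[[], [], [], [], [], [], [2, 2, 2], [], [], []], [[-1, 0, 1, 4, 5, 6, 6, 6, 7, 6, 5, 2,
        1], [], [], [], [-1, -2, -3, -3, -3, -3, -3, -3, -2, -1], [], [-1, 0, 1, 3, 5, 7, 10, 11,
        13, 12, 11, 9, 7, 5, 2, 1], [], [], [1, 2, 5, 7, 11, 13, 16, 17, 17, 16, 13, 11, 7, 5, 2,
        1]], [[], [], [], [-2, -2, -2, -2, -2, -2, -2, -2], [], [], [-2, -2, -4, -4, -6, -6, -6,
        -6, -4, -4, -2, -2], [], [2, 2, 2, 2, 2, 2, 2, 2], [-2, -2, -4, -4, -6, -6, -6, -6, -4,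
        -4, -2, -2]], [[], [], [], [], [], [], [], [], [], [2, 2, 4, 2, 4, 2, 4, 2, 2]], [[], [],
        [], [], [], [], [], [], [], []]] }]

/-- The certificate for the homology in degree `k`. -/
def homologyCert (k : ℕ) : HomologyCert :=
  homologyCerts.getD k ⟨1, [], [], [], [], [], [], []⟩

/-- The number of basis elements in degree `k - 1`. -/
def prevCount : ℕ → ℕ
  | 0 => 0
  | k + 1 => cellCount k

/-- The boundary matrix out of degree `k`. -/
def prevTable : ℕ → PolyTable
  | 0 => []
  | k + 1 => boundaryTable k

instance (K : HomologyCert) (l n m : ℕ) (B A : PolyTable) (d : List (List ℤ)) :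
    Decidable (K.Valid l n m B A d) :=
  decidable_of_iff
    (K.scale ≠ 0 ∧ K.den.headD 0 ≠ 0 ∧
      (∀ i < l, ∀ j < d.length, listEq (B.mulEntry n K.ψ i j) [] = true) ∧
      (∀ i < d.length, ∀ j < m,
        listEq (K.φ.mulEntry n A i j) (listMul (d.getD i []) (K.Y.entry i j)) = true) ∧
      (∀ i < n, ∀ j < d.length,
        listEq (listMul (K.ψ.entry i j) (d.getD j [])) (A.mulEntry m K.X i j) = true) ∧
      (∀ i < d.length, ∀ j < d.length,
        listEq (K.φ.mulEntry n K.ψ i j) (if i = j then [K.scale] else []) = true) ∧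
      (∀ i < n, ∀ j < n,
        listEq (listMul K.den (if i = j then [K.scale] else []))
          (listAdd (listMul K.den
            (listAdd (K.ψ.mulEntry d.length K.φ i j) (A.mulEntry m K.U i j)))
            (K.V.mulEntry l B i j)) = true))
    ⟨fun ⟨h₁, h₂, h₃, h₄, h₅, h₆, h₇⟩ => ⟨h₁, h₂, h₃, h₄, h₅, h₆, h₇⟩,
      fun ⟨h₁, h₂, h₃, h₄, h₅, h₆, h₇⟩ => ⟨h₁, h₂, h₃, h₄, h₅, h₆, h₇⟩⟩

theorem homologyCert_valid : ∀ k < 5, (homologyCert k).Valid (prevCount k) (cellCount k)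
    (cellCount (k + 1)) (prevTable k) (boundaryTable k) (torsion k) := by
  decide +kernel

/-- The coefficient list `t` describes the coefficient of `e_τ` in `∂ e_σ`. -/
def coeffValid (σ τ : Finset (Fin 5)) (t : List ℤ) : Prop :=
  (∀ s ∈ σ, τ = σ.erase s → listEq (listMul (parabolicData τ).poly t)
    (listScale ((-1) ^ (σ.filter fun t => t < s).card) (parabolicData σ).poly) = true) ∧
  ((∀ s ∈ σ, τ ≠ σ.erase s) → t = [])

instance (σ τ : Finset (Fin 5)) (t : List ℤ) : Decidable (coeffValid σ τ t) := by
  unfold coeffValid; infer_instance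

theorem boundaryTable_valid : ∀ k < 4, ∀ i < cellCount k, ∀ j < cellCount (k + 1),
    coeffValid (cell (k + 1) j) (cell k i) ((boundaryTable k).entry i j) := by
  decide +kernel

theorem headD_parabolicData : ∀ σ : Finset (Fin 5), (parabolicData σ).poly.headD 0 ≠ 0 := by
  decide +kernel

section Complex

variable {W : Type*} [Group W] {Mat : CoxeterMatrix (Fin 5)} (cs : CoxeterSystem Mat W)

theorem bcoeff_eq_laurentOf {σ τ : Finset (Fin 5)} {t : List ℤ}
    (hσ : poin cs σ = listPoly (parabolicData σ).poly)
    (hτ : poin cs τ = listPoly (parabolicData τ).poly) (h : coeffValid σ τ t) :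
    bcoeff cs σ τ = laurentOf t := by
  unfold bcoeff
  by_cases hs : ∃ s ∈ σ, τ = σ.erase s
  · obtain ⟨s, hs, rfl⟩ := hs
    rw [Finset.sum_eq_single_of_mem s hs, if_pos rfl]
    · have heq := listPoly_eq (h.1 s hs rfl)
      rw [listPoly_mul, listPoly_scale, ← hσ, ← hτ] at heq
      have hne : poin cs (σ.erase s) ≠ 0 := by
        rw [hτ]
        exact listPoly_ne_zero (headD_parabolicData _)
      set ε : ℤ := (-1) ^ (σ.filter fun t => t < s).card with hε
      have hεε : (C (ε : ℚ) : ℚ[X]) * C (ε : ℚ) = 1 := by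
        rw [← C_mul, hε]
        push_cast
        rw [← mul_pow]
        simp
      have hdiv : poin cs σ / poin cs (σ.erase s) = C (ε : ℚ) * listPoly t := by
        have hmul : poin cs σ = C (ε : ℚ) * listPoly t * poin cs (σ.erase s) := by
          rw [mul_assoc, mul_comm (listPoly t), heq, ← mul_assoc, hεε, one_mul]
        rw [hmul]
        exact mul_div_cancel_right₀ _ hne
      have hε' : (-1 : R) ^ (σ.filter fun t => t < s).card =
          Polynomial.toLaurent (C (ε : ℚ) : ℚ[X]) := by
        rw [hε]
        simp
      rw [hdiv, hε', ← map_mul, ← mul_assoc, hεε, one_mul]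
      rfl
    · intro s' hs' hne
      refine if_neg fun h' => ?_
      have : s' ∈ σ.erase s := Finset.mem_erase.2 ⟨hne, hs'⟩
      rw [h'] at this
      exact Finset.notMem_erase _ _ this
  · push Not at hs
    rw [h.2 hs, laurentOf_nil]
    exact Finset.sum_eq_zero fun s hs' => if_neg (hs s hs')

variable {ρ : W →* Function.End ℤ}

theorem exists_cellEquiv (hM : ∀ i j, Mat.M i j = coxF4 i j)
    (hρ : ∀ i, ρ (cs.simple i) = reflEnd i) (k : ℕ) :
    ∃ e : Fin (cellCount k) ≃ KW cs k, ∀ i, (e i).1 = cell k i := by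
  have hlt : ∀ i : Fin (cellCount k), k < 5 := fun i => by
    by_contra hk
    exact absurd (cellCount_eq_zero (by omega)) (Fin.pos i).ne'
  let f : Fin (cellCount k) → KW cs k := fun i =>
    ⟨cell k i, (cell_card k (hlt i) i i.2).1,
      (parabolicFacts cs hM hρ (cell_card k (hlt i) i i.2).2).finite⟩
  refine ⟨Equiv.ofBijective f ⟨fun i j hij => ?_, ?_⟩, fun i => rfl⟩
  · exact Fin.ext (cell_injective k (hlt i) i i.2 j j.2 (congrArg Subtype.val hij))
  · rintro ⟨σ, rfl, hfin⟩
    obtain ⟨i, hi, h⟩ := exists_cell σ fun h => infinite_parabolic_univ cs hρ (h ▸ hfin)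
    exact ⟨⟨i, hi⟩, Subtype.ext h⟩

theorem bdry_apply (hM : ∀ i j, Mat.M i j = coxF4 i j)
    (hρ : ∀ i, ρ (cs.simple i) = reflEnd i) {k : ℕ}
    {e : Fin (cellCount k) ≃ KW cs k} (he : ∀ i, (e i).1 = cell k i)
    {e' : Fin (cellCount (k + 1)) ≃ KW cs (k + 1)} (he' : ∀ i, (e' i).1 = cell (k + 1) i)
    (x : KW cs (k + 1) → R) :
    bdry cs k x ∘ e =
      ((boundaryTable k).toMatrix (cellCount k) (cellCount (k + 1))).mulVec (x ∘ e') := by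
  funext i
  change ∑ σ, bcoeff cs σ.1 (e i).1 * x σ = ∑ j, laurentOf _ * x (e' j)
  rw [← Equiv.sum_comp e']
  refine Finset.sum_congr rfl fun j _ => ?_
  have hk : k < 4 := by
    by_contra hk
    exact absurd (cellCount_eq_zero (by omega)) (Fin.pos j).ne'
  rw [he, he', bcoeff_eq_laurentOf cs
    (parabolicFacts cs hM hρ (cell_card _ (by omega) j j.2).2).poin_eq
    (parabolicFacts cs hM hρ (cell_card _ (by omega) i i.2).2).poin_eq
    (boundaryTable_valid k hk i i.2 j j.2)]

theorem mem_cycles_iff (hM : ∀ i j, Mat.M i j = coxF4 i j)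
    (hρ : ∀ i, ρ (cs.simple i) = reflEnd i) {k : ℕ}
    {e : Fin (cellCount k) ≃ KW cs k} (he : ∀ i, (e i).1 = cell k i) (z : KW cs k → R) :
    z ∈ cycles cs k ↔
      ((prevTable k).toMatrix (prevCount k) (cellCount k)).mulVec (z ∘ e) = 0 := by
  cases k with
  | zero => exact ⟨fun _ => funext fun i => i.elim0, fun _ => Submodule.mem_top⟩
  | succ k =>
    obtain ⟨e₀, he₀⟩ := exists_cellEquiv cs hM hρ k
    change bdry cs k z = 0 ↔ ((boundaryTable k).toMatrix (cellCount k) _).mulVec (z ∘ e) = 0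
    rw [← bdry_apply cs hM hρ he₀ he]
    constructor
    · intro h
      rw [h]
      rfl
    · intro h
      funext i
      obtain ⟨j, rfl⟩ := e₀.surjective i
      exact congrFun h j

theorem nonempty_homology_equiv (hM : ∀ i j, Mat.M i j = coxF4 i j)
    (hρ : ∀ i, ρ (cs.simple i) = reflEnd i) {k : ℕ} (hk : k < 5) :
    Nonempty (Hgy cs k ≃ₗ[R] TorsionModule (torsion k)) := by
  obtain ⟨e, he⟩ := exists_cellEquiv cs hM hρ k
  obtain ⟨e', he'⟩ := exists_cellEquiv cs hM hρ (k + 1)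
  have hv := homologyCert_valid k hk
  refine nonempty_quotient_equiv (cycles cs k) (LinearMap.range (bdry cs k))
    (torsionMap (torsion k) ((homologyCert k).φ.toMatrix _ (cellCount k)) ∘ₗ
      LinearMap.funLeft R R e) (fun y => ?_) fun z hz => ?_
  · obtain ⟨z, hz, hy⟩ := hv.surjective y
    have hze : (z ∘ e.symm) ∘ e = z := by
      funext i
      simp
    refine ⟨z ∘ e.symm, (mem_cycles_iff cs hM hρ he _).2 (by rwa [hze]), ?_⟩
    change torsionMap _ _ ((z ∘ e.symm) ∘ e) = y
    rwa [hze]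
  · change torsionMap _ _ (z ∘ e) = 0 ↔ _
    rw [hv.torsionMap_eq_zero_iff ((mem_cycles_iff cs hM hρ he z).1 hz), LinearMap.mem_range]
    constructor
    · rintro ⟨x, hx⟩
      refine ⟨x ∘ e'.symm, ?_⟩
      have h := bdry_apply cs hM hρ he he' (x ∘ e'.symm)
      rw [Function.comp_assoc, Equiv.symm_comp_self, Function.comp_id, hx] at h
      funext i
      obtain ⟨j, rfl⟩ := e.surjective i
      exact congrFun h j
    · rintro ⟨x, rfl⟩
      exact ⟨x ∘ e', (bdry_apply cs hM hρ he he' x).symm⟩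

theorem subsingleton_homology (hM : ∀ i j, Mat.M i j = coxF4 i j)
    (hρ : ∀ i, ρ (cs.simple i) = reflEnd i) {k : ℕ} (hk : 5 ≤ k) :
    Subsingleton (Hgy cs k) := by
  obtain ⟨e, -⟩ := exists_cellEquiv cs hM hρ k
  have : IsEmpty (KW cs k) := ⟨fun σ => (Fin.pos (e.symm σ)).ne' (cellCount_eq_zero hk)⟩
  exact (Submodule.mkQ_surjective _).subsingleton

theorem coxeterMatrix_eq (hM : ∀ i j : Fin 5, i.val < j.val →
      Mat.M i j = (if (i.val, j.val) ∈ ([(0, 1), (1, 2), (3, 4)] : List (ℕ × ℕ)) then 3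
        else if (i.val, j.val) ∈ ([(2, 3)] : List (ℕ × ℕ)) then 4 else 2)) (i j : Fin 5) :
    Mat.M i j = coxF4 i j := by
  have hdec : ∀ i j : Fin 5, (i.val < j.val →
      (if (i.val, j.val) ∈ ([(0, 1), (1, 2), (3, 4)] : List (ℕ × ℕ)) then 3
        else if (i.val, j.val) ∈ ([(2, 3)] : List (ℕ × ℕ)) then 4 else 2) = coxF4 i j) ∧
      coxF4 i j = coxF4 j i ∧ coxF4 i i = 1 := by
    decide
  rcases lt_trichotomy i.val j.val with h | h | h
  · exact (hM i j h).trans ((hdec i j).1 h)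
  · rw [Fin.ext h, (hdec j j).2.2]
    exact Mat.diagonal j
  · rw [← (hdec j i).2.1, ← (hdec j i).1 h, ← hM j i h]
    exact Mat.symmetric i j

end Complex

/-- Homology of the weighted complex for the affine Coxeter system of type `F̃₄`. -/
theorem homology_affine_F4 {W : Type*} [Group W] {Mat : CoxeterMatrix (Fin 5)}
    (cs : CoxeterSystem Mat W)
    (hM : ∀ i j : Fin 5, i.val < j.val →
      Mat.M i j = (if (i.val, j.val) ∈ ([(0, 1), (1, 2), (3, 4)] : List (ℕ × ℕ)) then 3
        else if (i.val, j.val) ∈ ([(2, 3)] : List (ℕ × ℕ)) then 4 else 2)) :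
    Nonempty (Hgy cs 0 ≃ₗ[R] (CycQuot 2)) ∧
    Nonempty (Hgy cs 1 ≃ₗ[R] (CycQuot 2)) ∧
    Nonempty (Hgy cs 2 ≃ₗ[R] (CycQuot 2 × CycQuot 3)) ∧
    Nonempty (Hgy cs 3 ≃ₗ[R] (CycQuot 2 × CycQuot 2 × CycQuot 3 × CycQuot 4 × CycQuot 8)) ∧
    Nonempty (Hgy cs 4 ≃ₗ[R] R) ∧
    (∀ k, 5 ≤ k → Subsingleton (Hgy cs k)) := by
  have hM' := coxeterMatrix_eq hM
  obtain ⟨ρ, hρ⟩ := exists_action cs hM'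
  obtain ⟨h0⟩ := nonempty_homology_equiv cs hM' hρ (k := 0) (by norm_num)
  obtain ⟨h1⟩ := nonempty_homology_equiv cs hM' hρ (k := 1) (by norm_num)
  obtain ⟨h2⟩ := nonempty_homology_equiv cs hM' hρ (k := 2) (by norm_num)
  obtain ⟨h3⟩ := nonempty_homology_equiv cs hM' hρ (k := 3) (by norm_num)
  obtain ⟨h4⟩ := nonempty_homology_equiv cs hM' hρ (k := 4) (by norm_num)
  obtain ⟨t0⟩ := nonempty_torsionModule_two
  obtain ⟨t2⟩ := nonempty_torsionModule_two_three
  obtain ⟨t3⟩ := nonempty_torsionModule_two_eight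
  obtain ⟨t4⟩ := nonempty_torsionModule_free
  exact ⟨⟨h0.trans t0⟩, ⟨h1.trans t0⟩, ⟨h2.trans t2⟩, ⟨h3.trans t3⟩, ⟨h4.trans t4⟩,
    fun k hk => subsingleton_homology cs hM' hρ hk⟩
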